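/- arXiv:0802.2854 — 2 statements merged into one kernel-verified Lean document; each statement's English description precedes it below -/
import Mathlib

section
/- For all integers k ≥ 1, d ≥ 1 and t ≥ 2, every vertex-weighted undirected graph of treewidth at most k with maximum degree at most d has a (t, ⌈K/2⌉^{2t})-trimming, where K = (9k+7)d(d+1) - 1. Consequently, every family of graphs with bounded degree and bounded treewidth is trimmable. -/
open scoped Classical

/-- A tree decomposition of a graph `G`. -/
structure TreeDecomp (V : Type) (G : SimpleGraph V) where
  X : Type
  T : SimpleGraph X
  tree : T.IsTree
  B : X → Finset V
  cover : ∀ v : V, ∃ x : X, v ∈ B x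
  edges : ∀ u v : V, G.Adj u v → ∃ x : X, u ∈ B x ∧ v ∈ B x
  subtree : ∀ (v : V) (x y z : X) (p : T.Walk x z), p.IsPath → y ∈ p.support →
    v ∈ B x → v ∈ B z → v ∈ B y

/-- `G` has treewidth at most `k`. -/
def TreewidthLE {V : Type} (G : SimpleGraph V) (k : ℕ) : Prop :=
  ∃ D : TreeDecomp V G, ∀ x : D.X, (D.B x).card ≤ k + 1

/-- A `(t,g)`-trimming of a vertex-weighted graph. -/
def IsTrimming {V : Type} [Fintype V] (G : SimpleGraph V) (w : V → ℝ)
    (t g : ℝ) (U : Finset V) : Prop :=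
  (∑ v ∈ U, w v) ≤ (∑ v, w v) / t ∧
    ∀ (u v : V) (p : G.Walk u v), p.IsPath → (p.length : ℝ) > g →
      ∃ x ∈ p.support, x ∈ U

theorem group_colours {V C : Type} (S : Finset V) (c : V → C) (n : ℕ) (hn : S.card ≤ n)
    (h : ∀ y, 2 * (S.filter (fun v => c v = y)).card ≤ n) :
    ∃ I : Finset C, 3 * (S.filter (fun v => c v ∈ I)).card ≤ 2 * n ∧
      3 * (S.filter (fun v => c v ∉ I)).card ≤ 2 * n := by
  by_cases hs : 3 * S.card ≤ n
  · refine ⟨∅, by simp, ?_⟩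
    simp; omega
  have hex : ∃ m, ∃ I : Finset C, I.card = m ∧ n ≤ 3 * (S.filter (fun v => c v ∈ I)).card := by
    refine ⟨_, S.image c, rfl, ?_⟩
    rw [Finset.filter_true_of_mem (fun v hv => Finset.mem_image_of_mem c hv)]
    omega
  obtain ⟨I, hI, hI2⟩ := Nat.find_spec hex
  have hmin := fun m hm => Nat.find_min hex (m := m) hm
  rw [← hI] at hmin
  have hadd := Finset.card_filter_add_card_filter_not (s := S) (fun v => c v ∈ I)
  refine ⟨I, ?_, by omega⟩
  by_contra hbig
  have hne : I.Nonempty := by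
    rw [Finset.nonempty_iff_ne_empty]; rintro rfl; simp at hbig
  obtain ⟨y, hy⟩ := hne
  have h1 : ¬ n ≤ 3 * (S.filter (fun v => c v ∈ I.erase y)).card := fun hh =>
    hmin _ (Finset.card_erase_lt_of_mem hy) ⟨_, rfl, hh⟩
  have h2 : (S.filter (fun v => c v ∈ I)).card ≤
      (S.filter (fun v => c v ∈ I.erase y)).card + (S.filter (fun v => c v = y)).card := by
    refine le_trans (Finset.card_le_card ?_) (Finset.card_union_le _ _)
    intro v; simp only [Finset.mem_filter, Finset.mem_union, Finset.mem_erase]; tauto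
  by_cases h3 : n ≤ 3 * (S.filter (fun v => c v = y)).card
  · have h4 : ¬ ({y} : Finset C).card < I.card := by
      intro hh
      exact hmin _ hh ⟨{y}, rfl, by simpa using h3⟩
    have h5 : I = {y} := (Finset.eq_of_subset_of_card_le (by simpa using hy) (by omega)).symm
    subst h5
    have := h y
    simp only [Finset.mem_singleton] at hbig
    omega
  · omega

/-- median node -/
theorem exists_separator {V X : Type} (T : SimpleGraph X) (hT : T.IsTree) (S : Finset V)
    (τ : V → X) (x : X)
    (hx : ∀ y, ∑ v ∈ S, T.dist x (τ v) ≤ ∑ v ∈ S, T.dist y (τ v)) (z0 : X) (hz0 : z0 ≠ x) :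
    2 * (S.filter (fun v => ∃ p : T.Walk z0 (τ v), x ∉ p.support)).card ≤ S.card := by
  obtain ⟨p, hp⟩ := (hT.connected.preconnected x z0).exists_isPath
  cases p with
  | nil => exact absurd rfl hz0
  | @cons _ y _ hadj q =>
    rw [SimpleGraph.Walk.cons_isPath_iff] at hp
    set F := S.filter (fun v => ∃ p : T.Walk z0 (τ v), x ∉ p.support) with hF
    have hd1 : ∀ v ∈ F, T.dist y (τ v) + 1 ≤ T.dist x (τ v) := by
      intro v hv
      obtain ⟨-, r, hr⟩ := Finset.mem_filter.1 hv
      have hb : x ∉ (q.append r).bypass.support := by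
        intro hh
        have := SimpleGraph.Walk.support_bypass_subset_support _ hh
        rw [SimpleGraph.Walk.mem_support_append_iff] at this
        tauto
      have hpath : (SimpleGraph.Walk.cons hadj (q.append r).bypass).IsPath := by
        rw [SimpleGraph.Walk.cons_isPath_iff]
        exact ⟨SimpleGraph.Walk.bypass_isPath _, hb⟩
      obtain ⟨m, hm, hml⟩ := hT.connected.exists_path_of_dist x (τ v)
      have heq := (hT.isAcyclic.subsingleton_path x (τ v)).elim ⟨_, hpath⟩ ⟨m, hm⟩
      have heq2 := congrArg (fun z => z.1.length) heq
      simp only [SimpleGraph.Walk.length_cons] at heq2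
      have := SimpleGraph.dist_le (q.append r).bypass
      omega
    have hd2 : ∀ v, T.dist y (τ v) ≤ T.dist x (τ v) + 1 := by
      intro v
      have h1 := hT.connected.dist_triangle (u := y) (v := x) (w := τ v)
      have h2 : T.dist y x = 1 := SimpleGraph.dist_eq_one_iff_adj.2 hadj.symm
      omega
    have hsum := hx y
    have e1 := Finset.sum_filter_add_sum_filter_not S
      (fun v => ∃ p : T.Walk z0 (τ v), x ∉ p.support) (fun v => T.dist x (τ v))
    have e2 := Finset.sum_filter_add_sum_filter_not S
      (fun v => ∃ p : T.Walk z0 (τ v), x ∉ p.support) (fun v => T.dist y (τ v))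
    have e3 := Finset.card_filter_add_card_filter_not (s := S)
      (fun v => ∃ p : T.Walk z0 (τ v), x ∉ p.support)
    have e4 := Finset.sum_le_sum hd1
    have e5 := Finset.sum_le_sum (s := S.filter (fun v => ¬ ∃ p : T.Walk z0 (τ v), x ∉ p.support))
      (fun v _ => hd2 v)
    rw [Finset.sum_add_distrib] at e4 e5
    simp only [Finset.sum_const, smul_eq_mul, mul_one] at e4 e5
    rw [← hF] at e1 e2 e3
    omega

theorem separator {V : Type} {G : SimpleGraph V} (D : TreeDecomp V G) (c : ℕ)
    (hc : ∀ x, (D.B x).card ≤ c) (S : Finset V) :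
    ∃ (X : Finset V) (P : Set V), X.card ≤ c ∧
      (∀ u v, G.Adj u v → u ∉ X → v ∉ X → (u ∈ P ↔ v ∈ P)) ∧
      3 * (S.filter (fun v => v ∉ X ∧ v ∈ P)).card ≤ 2 * S.card ∧
      3 * (S.filter (fun v => v ∉ X ∧ v ∉ P)).card ≤ 2 * S.card := by
  choose τ hτ using D.cover
  have : Nonempty D.X := D.tree.connected.nonempty
  let Φ : D.X → ℕ := fun x => ∑ v ∈ S, D.T.dist x (τ v)
  obtain ⟨x, hx⟩ : ∃ x, ∀ y, Φ x ≤ Φ y :=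
    ⟨Function.argmin Φ, fun y => Function.argmin_le Φ y⟩
  let col : V → Set D.X := fun v => {z | ∃ p : D.T.Walk (τ v) z, x ∉ p.support}
  have key : ∀ v z, v ∉ D.B x → v ∈ D.B z → ∃ p : D.T.Walk (τ v) z, x ∉ p.support := by
    intro v z hv hz
    obtain ⟨p, hp⟩ := (D.tree.connected.preconnected (τ v) z).exists_isPath
    exact ⟨p, fun h => hv (D.subtree v _ _ _ p hp h (hτ v) hz)⟩
  have hcol : ∀ u v, (∃ p : D.T.Walk (τ u) (τ v), x ∉ p.support) → col u = col v := by
    rintro u v ⟨p, hp⟩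
    ext z
    constructor
    · rintro ⟨q, hq⟩
      refine ⟨p.reverse.append q, ?_⟩
      rw [SimpleGraph.Walk.mem_support_append_iff]; simp [hp, hq]
    · rintro ⟨q, hq⟩
      refine ⟨p.append q, ?_⟩
      rw [SimpleGraph.Walk.mem_support_append_iff]; simp [hp, hq]
  obtain ⟨I, h1, h2⟩ := group_colours (S.filter (fun v => v ∉ D.B x)) col S.card
    (Finset.card_filter_le _ _) (by
      intro y
      by_cases hu : ∃ u, u ∉ D.B x ∧ col u = y
      swap
      · rw [Finset.filter_false_of_mem]
        · simp
        · intro v hv hv2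
          exact hu ⟨v, (Finset.mem_filter.1 hv).2, hv2⟩
      · obtain ⟨u, hu1, hu2⟩ := hu
        refine le_trans ?_ (exists_separator D.T D.tree S τ x hx (τ u)
          (fun h => hu1 (h ▸ hτ u)))
        refine Nat.mul_le_mul_left _ (Finset.card_le_card ?_)
        intro v hv
        simp only [Finset.mem_filter] at hv ⊢
        refine ⟨hv.1.1, ?_⟩
        have : τ v ∈ col u := by
          rw [hu2, ← hv.2]
          exact key v _ hv.1.2 (hτ v)
        exact this)
  refine ⟨D.B x, {v | col v ∈ I}, hc x, ?_, ?_, ?_⟩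
  · intro u v huv hu hv
    obtain ⟨z, hz1, hz2⟩ := D.edges u v huv
    obtain ⟨p, hp⟩ := key u z hu hz1
    obtain ⟨q, hq⟩ := key v z hv hz2
    have : col u = col v := hcol u v ⟨p.append q.reverse, by
      rw [SimpleGraph.Walk.mem_support_append_iff]; simp [hp, hq]⟩
    simp [this]
  · rw [Finset.filter_filter] at h1; convert h1; exact Iff.rfl
  · rw [Finset.filter_filter] at h2; convert h2; exact Iff.rfl

theorem chain_const {V C : Type} (R : V → V → Prop) (f : V → C) (l : List V)
    (hl : l.IsChain R) (h : ∀ u ∈ l, ∀ v ∈ l, R u v → f u = f v) :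
    ∀ u ∈ l, ∀ v ∈ l, f u = f v := by
  have key : ∀ (l : List V) (a : V), (a :: l).IsChain R →
      (∀ u ∈ a :: l, ∀ v ∈ a :: l, R u v → f u = f v) → ∀ v ∈ a :: l, f v = f a := by
    intro l
    induction l with
    | nil => intro a _ _ v hv; simp at hv; rw [hv]
    | cons b l ih =>
      intro a hc hh v hv
      rw [List.isChain_cons_cons] at hc
      have hba : f a = f b := hh a (by simp) b (by simp) hc.1
      rcases List.mem_cons.1 hv with rfl | hv
      · rfl
      · rw [hba]
        exact ih b hc.2 (fun u hu v hv => hh u (List.mem_cons_of_mem _ hu) v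
          (List.mem_cons_of_mem _ hv)) v hv
  cases l with
  | nil => intro u hu; simp at hu
  | cons a l =>
    intro u hu v hv
    rw [key l a hl h u hu, key l a hl h v hv]

def Good {V : Type} (G : SimpleGraph V) (s : ℕ) (A : Finset V) (f : V → ℕ) : Prop :=
  (∀ u ∈ A, ∀ v ∈ A, G.Adj u v → f u ≤ f v + 1) ∧
  ∀ j, 1 ≤ j → ∀ l : List V, l.IsChain G.Adj → (∀ v ∈ l, v ∈ A ∧ j ≤ f v) →
    (l.toFinset.filter (fun v => f v = j)).card ≤ s

set_option maxHeartbeats 1000000 in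
theorem exists_layering {V : Type} [Fintype V] (G : SimpleGraph V) (c d : ℕ) (hc : 1 ≤ c)
    (hd : 1 ≤ d)
    (hdeg : ∀ v, (Finset.univ.filter (fun u => G.Adj v u)).card ≤ d)
    (hsep : ∀ S : Finset V, ∃ (X : Finset V) (P : Set V), X.card ≤ c ∧
      (∀ u v, G.Adj u v → u ∉ X → v ∉ X → (u ∈ P ↔ v ∈ P)) ∧
      3 * (S.filter (fun v => v ∉ X ∧ v ∈ P)).card ≤ 2 * S.card ∧
      3 * (S.filter (fun v => v ∉ X ∧ v ∉ P)).card ≤ 2 * S.card) :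
    ∀ (n : ℕ) (A S : Finset V), A.card = n → S ⊆ A → S.card ≤ 12 * (c * d) →
      ∃ f : V → ℕ, Good G (24 * (c * d)) A f ∧ (∀ v ∈ S, f v = 0) ∧
        (A.filter (fun v => f v = 0)).card ≤ max (4 * c) (2 * S.card - 4 * c) := by
  have hcd : c ≤ c * d := Nat.le_mul_of_pos_right _ hd
  intro n
  induction n using Nat.strong_induction_on with
  | _ n ih =>
  -- small nonempty root
  have small : ∀ A S : Finset V, A.card = n → S ⊆ A → S.Nonempty → S.card ≤ 12 * c →
      ∃ f : V → ℕ, Good G (24 * (c * d)) A f ∧ (∀ v ∈ S, f v = 0) ∧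
        (A.filter (fun v => f v = 0)) ⊆ S := by
    intro A S hA hSA hne hS
    have hlt : (A \ S).card < n := by
      rw [← hA]
      refine Finset.card_lt_card ⟨Finset.sdiff_subset, fun h => ?_⟩
      obtain ⟨v, hv⟩ := hne
      exact (Finset.mem_sdiff.1 (h (hSA hv))).2 hv
    let S' := (A \ S).filter (fun v => ∃ u ∈ S, G.Adj u v)
    have hS' : S'.card ≤ 12 * (c * d) := by
      have h1 : S' ⊆ S.biUnion (fun v => Finset.univ.filter (fun u => G.Adj v u)) := by
        intro v hv
        obtain ⟨-, u, hu, huv⟩ := Finset.mem_filter.1 hv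
        simp only [Finset.mem_biUnion, Finset.mem_filter, Finset.mem_univ, true_and]
        exact ⟨u, hu, huv⟩
      have h2 := Finset.card_le_card h1
      have h3 := Finset.card_biUnion_le_card_mul S
        (fun v => Finset.univ.filter (fun u => G.Adj v u)) d (fun v _ => hdeg v)
      have h4 : S.card * d ≤ 12 * c * d := Nat.mul_le_mul_right _ hS
      rw [mul_assoc] at h4
      omega
    obtain ⟨f, ⟨hf1, hf2⟩, hf3, hf4⟩ := ih _ hlt (A \ S) S' rfl (Finset.filter_subset _ _) hS'
    refine ⟨fun v => if v ∈ S then 0 else f v + 1, ⟨?_, ?_⟩, ?_, ?_⟩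
    · intro u hu v hv huv
      by_cases h1 : u ∈ S
      · simp [h1]
      · by_cases h2 : v ∈ S
        · have : f u = 0 := hf3 u (by
            simp only [S', Finset.mem_filter, Finset.mem_sdiff]
            exact ⟨⟨hu, h1⟩, v, h2, huv.symm⟩)
          simp [h1, h2, this]
        · have := hf1 u (by simp [hu, h1]) v (by simp [hv, h2]) huv
          simp only [h1, h2, if_false]; omega
    · intro j hj l hl hlj
      have hns : ∀ v ∈ l, v ∈ A \ S ∧ j ≤ f v + 1 := by
        intro v hv
        have := hlj v hv
        by_cases h : v ∈ S
        · simp [h] at this; omega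
        · simp only [h, if_false] at this
          exact ⟨by simp [h, this.1], this.2⟩
      rcases Nat.eq_or_lt_of_le hj with h | h
      · refine le_trans (Finset.card_le_card (t := (A \ S).filter (fun v => f v = 0)) ?_)
          (le_trans hf4 ?_)
        · intro v hv
          simp only [Finset.mem_filter, List.mem_toFinset] at hv
          have h1 := (hns v hv.1).1
          have h2 := (Finset.mem_sdiff.1 h1).2
          simp only [h2, if_false] at hv
          rw [Finset.mem_filter]
          exact ⟨h1, by omega⟩
        · omega
      · refine le_trans (Finset.card_le_card ?_) (hf2 (j - 1) (by omega) l hl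
          (fun v hv => ⟨(hns v hv).1, by have := (hns v hv).2; omega⟩))
        intro v hv
        simp only [Finset.mem_filter, List.mem_toFinset] at hv ⊢
        have h2 := (Finset.mem_sdiff.1 (hns v hv.1).1).2
        simp only [h2, if_false] at hv
        exact ⟨hv.1, by omega⟩
    · intro v hv; simp [hv]
    · intro v hv
      by_contra h
      simp [h] at hv
  intro A S hA hSA hS
  rcases S.eq_empty_or_nonempty with rfl | hne
  · rcases A.eq_empty_or_nonempty with rfl | ⟨a, ha⟩
    · refine ⟨fun _ => 0, ⟨by simp, ?_⟩, by simp, by simp⟩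
      intro j hj l _ _
      have : (l.toFinset.filter (fun _ => 0 = j)) = ∅ := by
        apply Finset.filter_false_of_mem; intros; omega
      rw [this]; simp
    · obtain ⟨f, h1, h2, h3⟩ := small A {a} hA (by simpa using ha) (by simp) (by simp; omega)
      refine ⟨f, h1, by simp, ?_⟩
      have := Finset.card_le_card h3
      simp only [Finset.card_singleton] at this
      omega
  by_cases hsm : S.card ≤ 12 * c
  · obtain ⟨f, h1, h2, h3⟩ := small A S hA hSA hne hsm
    refine ⟨f, h1, h2, ?_⟩
    have := Finset.card_le_card h3
    omega
  obtain ⟨X, P, hX, hPX, hP1, hP2⟩ := hsep S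
  set a := (S.filter (fun v => v ∉ X ∧ v ∈ P)) with ha
  set b := (S.filter (fun v => v ∉ X ∧ v ∉ P)) with hb
  have hcov : S.card ≤ a.card + b.card + X.card := by
    have : S ⊆ (a ∪ b) ∪ X := by
      intro v hv
      simp only [ha, hb, Finset.mem_union, Finset.mem_filter]; tauto
    have h1 := Finset.card_le_card this
    have h2 := Finset.card_union_le (a ∪ b) X
    have h3 := Finset.card_union_le a b
    omega
  have hdis : a.card + b.card ≤ S.card := by
    rw [← Finset.card_union_of_disjoint]
    · apply Finset.card_le_card
      intro v; simp only [ha, hb, Finset.mem_union, Finset.mem_filter]; tauto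
    · rw [Finset.disjoint_left]
      intro v; simp only [ha, hb, Finset.mem_filter]; tauto
  let A1 := A.filter (fun v => v ∈ X ∨ v ∈ P)
  let A2 := A.filter (fun v => v ∈ X ∨ v ∉ P)
  let S1 := A1.filter (fun v => v ∈ S ∨ v ∈ X)
  let S2 := A2.filter (fun v => v ∈ S ∨ v ∈ X)
  have hA1 : A1.card < n := by
    rw [← hA]
    have hbn : b.Nonempty := by rw [← Finset.card_pos]; omega
    obtain ⟨v, hv⟩ := hbn
    refine Finset.card_lt_card ⟨Finset.filter_subset _ _, fun h => ?_⟩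
    simp only [hb, Finset.mem_filter] at hv
    have := (Finset.mem_filter.1 (h (hSA hv.1))).2
    tauto
  have hA2 : A2.card < n := by
    rw [← hA]
    have hbn : a.Nonempty := by rw [← Finset.card_pos]; omega
    obtain ⟨v, hv⟩ := hbn
    refine Finset.card_lt_card ⟨Finset.filter_subset _ _, fun h => ?_⟩
    simp only [ha, Finset.mem_filter] at hv
    have := (Finset.mem_filter.1 (h (hSA hv.1))).2
    tauto
  have hS1u : S1.card ≤ a.card + X.card := by
    refine le_trans (Finset.card_le_card ?_) (Finset.card_union_le _ _)
    intro v; simp only [S1, A1, ha, Finset.mem_union, Finset.mem_filter]; tauto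
  have hS2u : S2.card ≤ b.card + X.card := by
    refine le_trans (Finset.card_le_card ?_) (Finset.card_union_le _ _)
    intro v; simp only [S2, A2, hb, Finset.mem_union, Finset.mem_filter]; tauto
  have hS1l : S.card ≤ S1.card + b.card := by
    refine le_trans (Finset.card_le_card ?_) (Finset.card_union_le _ _)
    intro v hv; have := hSA hv
    simp only [S1, A1, hb, Finset.mem_union, Finset.mem_filter]; tauto
  have hS2l : S.card ≤ S2.card + a.card := by
    refine le_trans (Finset.card_le_card ?_) (Finset.card_union_le _ _)
    intro v hv; have := hSA hv
    simp only [S2, A2, ha, Finset.mem_union, Finset.mem_filter]; tauto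
  obtain ⟨f1, ⟨hf1, hg1⟩, hz1, hn1⟩ := ih _ hA1 A1 S1 rfl (Finset.filter_subset _ _) (by omega)
  obtain ⟨f2, ⟨hf2, hg2⟩, hz2, hn2⟩ := ih _ hA2 A2 S2 rfl (Finset.filter_subset _ _) (by omega)
  let f : V → ℕ := fun v => if v ∈ P then f1 v else f2 v
  have hX1 : ∀ v ∈ A, v ∈ X → f1 v = 0 := fun v hv hx => hz1 v (by
    simp only [S1, A1, Finset.mem_filter]; tauto)
  have hX2 : ∀ v ∈ A, v ∈ X → f2 v = 0 := fun v hv hx => hz2 v (by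
    simp only [S2, A2, Finset.mem_filter]; tauto)
  have hfX : ∀ v ∈ A, v ∈ X → f v = 0 := fun v hv hx => by
    simp only [f]; split_ifs; exacts [hX1 v hv hx, hX2 v hv hx]
  have hfA1 : ∀ v ∈ A1, f v = f1 v := by
    intro v hv
    obtain ⟨h1, h2⟩ := Finset.mem_filter.1 hv
    by_cases hx : v ∈ X
    · rw [hfX v h1 hx, hX1 v h1 hx]
    · have : v ∈ P := by tauto
      simp [f, this]
  have hfA2 : ∀ v ∈ A2, f v = f2 v := by
    intro v hv
    obtain ⟨h1, h2⟩ := Finset.mem_filter.1 hv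
    by_cases hx : v ∈ X
    · rw [hfX v h1 hx, hX2 v h1 hx]
    · have : v ∉ P := by tauto
      simp [f, this]
  refine ⟨f, ⟨?_, ?_⟩, ?_, ?_⟩
  · intro u hu v hv huv
    have hboth : (u ∈ A1 ∧ v ∈ A1) ∨ (u ∈ A2 ∧ v ∈ A2) := by
      have := hPX u v huv
      simp only [A1, A2, Finset.mem_filter]; tauto
    rcases hboth with ⟨h1, h2⟩ | ⟨h1, h2⟩
    · rw [hfA1 u h1, hfA1 v h2]; exact hf1 u h1 v h2 huv
    · rw [hfA2 u h1, hfA2 v h2]; exact hf2 u h1 v h2 huv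
  · intro j hj l hl hlj
    have hlX : ∀ v ∈ l, v ∉ X := by
      intro v hv hx
      have h1 := hlj v hv
      rw [hfX v h1.1 hx] at h1
      omega
    have hconst := chain_const G.Adj (fun v => (v ∈ P : Prop)) l hl
      (fun u hu v hv huv => propext (hPX u v huv (hlX u hu) (hlX v hv)))
    by_cases hp : ∃ u ∈ l, u ∈ P
    · obtain ⟨u, hu, hup⟩ := hp
      have hl1 : ∀ v ∈ l, v ∈ A1 := fun v hv => by
        have h1 : v ∈ P := by
          have := hconst u hu v hv
          simp only [hup, eq_iff_iff, true_iff] at this; exact this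
        simp only [A1, Finset.mem_filter]; exact ⟨(hlj v hv).1, Or.inr h1⟩
      refine le_trans (le_of_eq ?_) (hg1 j hj l hl
        (fun v hv => ⟨hl1 v hv, by rw [← hfA1 v (hl1 v hv)]; exact (hlj v hv).2⟩))
      congr 1
      apply Finset.filter_congr
      intro v hv
      rw [hfA1 v (hl1 v (by simpa using hv))]
    · have hl1 : ∀ v ∈ l, v ∈ A2 := fun v hv => by
        have h1 : v ∉ P := fun h => hp ⟨v, hv, h⟩
        simp only [A2, Finset.mem_filter]; exact ⟨(hlj v hv).1, Or.inr h1⟩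
      refine le_trans (le_of_eq ?_) (hg2 j hj l hl
        (fun v hv => ⟨hl1 v hv, by rw [← hfA2 v (hl1 v hv)]; exact (hlj v hv).2⟩))
      congr 1
      apply Finset.filter_congr
      intro v hv
      rw [hfA2 v (hl1 v (by simpa using hv))]
  · intro v hv
    have hvA := hSA hv
    by_cases hp : v ∈ P
    · have : v ∈ A1 := by simp only [A1, Finset.mem_filter]; tauto
      rw [hfA1 v this]
      exact hz1 v (by simp only [S1, Finset.mem_filter]; tauto)
    · have : v ∈ A2 := by simp only [A2, Finset.mem_filter]; tauto
      rw [hfA2 v this]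
      exact hz2 v (by simp only [S2, Finset.mem_filter]; tauto)
  · have hle : (A.filter (fun v => f v = 0)).card ≤
        (A1.filter (fun v => f1 v = 0)).card + (A2.filter (fun v => f2 v = 0)).card := by
      refine le_trans (Finset.card_le_card ?_) (Finset.card_union_le _ _)
      intro v hv
      obtain ⟨h1, h2⟩ := Finset.mem_filter.1 hv
      rw [Finset.mem_union]
      by_cases hp : v ∈ P
      · have : v ∈ A1 := by simp only [A1, Finset.mem_filter]; tauto
        exact Or.inl (Finset.mem_filter.2 ⟨this, by rw [← hfA1 v this]; exact h2⟩)
      · have : v ∈ A2 := by simp only [A2, Finset.mem_filter]; tauto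
        exact Or.inr (Finset.mem_filter.2 ⟨this, by rw [← hfA2 v this]; exact h2⟩)
    omega

theorem list_split {V : Type} (q : V → Prop) (N : ℕ) (m : ℕ) : ∀ l : List V, l.length ≤ m →
    (∀ l', l' <:+: l → (∀ v ∈ l', ¬ q v) → l'.length ≤ N) →
    l.length ≤ l.countP (fun v => decide (q v)) + (l.countP (fun v => decide (q v)) + 1) * N := by
  induction m with
  | zero => intro l hl _; omega
  | succ m ih =>
    intro l hl h
    by_cases hq : ∃ v ∈ l, q v
    swap
    · have := h l List.infix_rfl (fun v hv hv2 => hq ⟨v, hv, hv2⟩)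
      have h0 : 0 ≤ l.countP (fun v => decide (q v)) * N := Nat.zero_le _
      rw [add_mul]; omega
    · obtain ⟨l1, a, l2, rfl, hqa, h1⟩ : ∃ l1 a l2, l = l1 ++ a :: l2 ∧ q a ∧ ∀ v ∈ l1, ¬ q v := by
        clear ih h hl
        induction l with
        | nil => simp at hq
        | cons b l ihl =>
          by_cases hb : q b
          · exact ⟨[], b, l, rfl, hb, by simp⟩
          · obtain ⟨l1, a, l2, h1, h2, h3⟩ := ihl (by
              obtain ⟨v, hv, hv2⟩ := hq
              rcases List.mem_cons.1 hv with rfl | hv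
              · exact absurd hv2 hb
              · exact ⟨v, hv, hv2⟩)
            exact ⟨b :: l1, a, l2, by simp [h1], h2, by
              intro v hv
              rcases List.mem_cons.1 hv with rfl | hv
              · exact hb
              · exact h3 v hv⟩
      have hl1 := h l1 (List.prefix_append _ _).isInfix h1
      have hsuf : l2 <:+: l1 ++ a :: l2 := ⟨l1 ++ [a], [], by simp⟩
      simp only [List.length_append, List.length_cons] at hl ⊢
      have hl2 := ih l2 (by omega) (fun l' hl' => h l' (hl'.trans hsuf))
      have hc1 : l1.countP (fun v => decide (q v)) = 0 := by
        rw [List.countP_eq_zero]; simpa using h1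
      rw [List.countP_append, List.countP_cons, hc1]
      simp only [hqa, decide_true, if_true]
      nlinarith

theorem path_bound {V : Type} (G : SimpleGraph V) (f : V → ℕ) (s : ℕ)
    (hf : ∀ j, ∀ l : List V, l.IsChain G.Adj → (∀ v ∈ l, j ≤ f v) →
      (l.toFinset.filter (fun v => f v = j)).card ≤ s) (h : ℕ) :
    ∀ (j : ℕ) (l : List V), l.IsChain G.Adj → l.Nodup → (∀ v ∈ l, j ≤ f v ∧ f v < j + h) →
      l.length + 1 ≤ (s + 1) ^ h := by
  induction h with
  | zero =>
    intro j l _ _ hl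
    cases l with
    | nil => simp
    | cons a l => have := hl a (by simp); omega
  | succ h ih =>
    intro j l hc hnd hl
    have hcount : l.countP (fun v => decide (f v = j)) ≤ s := by
      refine le_trans (le_of_eq ?_) (hf j l hc (fun v hv => (hl v hv).1))
      rw [List.countP_eq_length_filter, ← List.toFinset_card_of_nodup (hnd.filter _)]
      congr 1
      ext v
      simp
    obtain ⟨N, hN⟩ : ∃ N, (s + 1) ^ h = N + 1 :=
      ⟨(s + 1) ^ h - 1, by have : 0 < (s + 1) ^ h := by positivity
                           omega⟩
    have hsp := list_split (fun v => f v = j) N l.length l le_rfl (by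
      intro l' hl' hq
      have := ih (j + 1) l' (hc.infix hl') (hnd.sublist hl'.sublist) (fun v hv => by
        have h1 := hl v (hl'.subset hv)
        have h2 := hq v hv
        omega)
      omega)
    have h2 : (l.countP (fun v => decide (f v = j)) + 1) * N ≤ (s + 1) * N :=
      Nat.mul_le_mul_right _ (by omega)
    rw [pow_succ, hN]
    nlinarith

/-- For `k, d ≥ 1` and `t ≥ 2`, every vertex-weighted graph of treewidth at most `k`
and maximum degree at most `d` has a `(t, ⌈K/2⌉^{2t})`-trimming, where
`K = (9k+7)d(d+1) - 1`. -/
theorem trimming_of_bounded_treewidth_and_degree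
    (k d t : ℕ) (hk : 1 ≤ k) (hd : 1 ≤ d) (ht : 2 ≤ t)
    {V : Type} [Fintype V] (G : SimpleGraph V) [DecidableRel G.Adj]
    (w : V → ℝ) (hw : ∀ v, 0 ≤ w v)
    (htw : TreewidthLE G k) (hdeg : ∀ v : V, G.degree v ≤ d)
    (K : ℕ) (hK : K = (9 * k + 7) * d * (d + 1) - 1) :
    ∃ U : Finset V, IsTrimming G w t ((((K + 1) / 2 : ℕ) : ℝ) ^ (2 * t)) U := by
  obtain ⟨D, hD⟩ := htw
  obtain ⟨f, ⟨hf1, hf2⟩, -, hf3⟩ := exists_layering G (k + 1) d (by omega) hd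
    (fun v => by
      refine le_trans (le_of_eq ?_) (hdeg v)
      rw [← SimpleGraph.card_neighborFinset_eq_degree]
      congr 1
      ext u
      simp)
    (separator D (k + 1) hD) _ Finset.univ ∅ rfl (by simp) (by simp)
  have hcd : k + 1 ≤ (k + 1) * d := Nat.le_mul_of_pos_right _ hd
  have hgood : ∀ j, ∀ l : List V, l.IsChain G.Adj → (∀ v ∈ l, j ≤ f v) →
      (l.toFinset.filter (fun v => f v = j)).card ≤ 24 * ((k + 1) * d) := by
    intro j l hl hj
    rcases Nat.eq_zero_or_pos j with rfl | hpos
    · refine le_trans (Finset.card_le_card (t := Finset.univ.filter (fun v => f v = 0)) ?_)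
        (le_trans hf3 ?_)
      · exact Finset.filter_subset_filter _ (Finset.subset_univ _)
      · simp only [Finset.card_empty]; omega
    · exact hf2 j hpos l hl (fun v hv => ⟨Finset.mem_univ _, hj v hv⟩)
  have hM : 24 * ((k + 1) * d) + 1 ≤ ((K + 1) / 2) ^ 2 := by
    have h1 : (9 * k + 7) * d ≤ (K + 1) / 2 := by
      rw [Nat.le_div_iff_mul_le (by norm_num)]
      have : (9 * k + 7) * d * 2 ≤ (9 * k + 7) * d * (d + 1) := Nat.mul_le_mul_left _ (by omega)
      omega
    have h2 : ((9 * k + 7) * d) ^ 2 ≤ ((K + 1) / 2) ^ 2 := Nat.pow_le_pow_left h1 2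
    refine le_trans ?_ h2
    have h3 : 16 ≤ (9 * k + 7) * d := by nlinarith
    nlinarith
  -- choose the residue class
  obtain ⟨i, hi, hiw⟩ : ∃ i ∈ Finset.range t,
      ∑ v ∈ Finset.univ.filter (fun v => f v % t = i), w v ≤ (∑ v, w v) / t := by
    have hsum : ∑ i ∈ Finset.range t, ∑ v ∈ Finset.univ.filter (fun v => f v % t = i), w v
        = ∑ v, w v :=
      Finset.sum_fiberwise_of_maps_to
        (fun v _ => Finset.mem_range.2 (Nat.mod_lt _ (by omega))) w
    apply Finset.exists_le_of_sum_le (Finset.nonempty_range_iff.2 (by omega))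
    rw [hsum, Finset.sum_const, Finset.card_range, nsmul_eq_mul]
    have : (t : ℝ) ≠ 0 := by
      have : t ≠ 0 := by omega
      exact_mod_cast this
    rw [mul_div_cancel₀ _ this]
  rw [Finset.mem_range] at hi
  refine ⟨Finset.univ.filter (fun v => f v % t = i), hiw, ?_⟩
  intro u v p hp hlen
  by_contra hno
  have hav : ∀ x ∈ p.support, f x % t ≠ i := fun x hx h => hno ⟨x, hx, by simp [h]⟩
  have hmod : ∀ x ∈ p.support, (f x + (t - i)) % t ≠ 0 := by
    intro x hx h0
    apply hav x hx
    obtain ⟨q, hq⟩ := Nat.dvd_of_mod_eq_zero h0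
    have hq1 : 1 ≤ q := by
      rcases Nat.eq_zero_or_pos q with rfl | h
      · simp at hq; omega
      · exact h
    obtain ⟨r, rfl⟩ := Nat.exists_eq_add_of_le' hq1
    have : f x = i + t * r := by rw [mul_add] at hq; omega
    rw [this, Nat.add_mul_mod_self_left, Nat.mod_eq_of_lt hi]
  have hstep : ∀ a b : ℕ, a ≤ b + 1 → b ≤ a + 1 → a % t ≠ 0 → b % t ≠ 0 → a / t = b / t := by
    have aux : ∀ a : ℕ, (a + 1) % t ≠ 0 → (a + 1) / t = a / t := by
      intro a h
      rw [Nat.succ_div, if_neg (fun hd => h (Nat.mod_eq_zero_of_dvd hd)), add_zero]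
    intro a b h1 h2 h3 h4
    have : a = b ∨ a = b + 1 ∨ b = a + 1 := by omega
    rcases this with rfl | rfl | rfl
    · rfl
    · exact aux _ h3
    · exact (aux _ h4).symm
  have hconst := chain_const G.Adj (fun x => (f x + (t - i)) / t) p.support
    p.isChain_adj_support (fun a ha b hb hab => hstep _ _
      (by have := hf1 a (Finset.mem_univ _) b (Finset.mem_univ _) hab; omega)
      (by have := hf1 b (Finset.mem_univ _) a (Finset.mem_univ _) hab.symm; omega)
      (hmod a ha) (hmod b hb))
  have hb := path_bound G f _ hgood t (t * ((f u + (t - i)) / t) + 1 + i - t) p.support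
    p.isChain_adj_support hp.support_nodup (by
      intro x hx
      have h1 := hconst x hx u p.start_mem_support
      have h2 := Nat.div_add_mod (f x + (t - i)) t
      have h3 := Nat.mod_lt (f x + (t - i)) (show 0 < t by omega)
      have h4 := hmod x hx
      rw [h1] at h2
      omega)
  rw [SimpleGraph.Walk.length_support] at hb
  have hb2 : (24 * ((k + 1) * d) + 1) ^ t ≤ ((K + 1) / 2) ^ (2 * t) := by
    rw [pow_mul]; exact Nat.pow_le_pow_left hM t
  have hlen2 : ((K + 1) / 2) ^ (2 * t) < p.length := by exact_mod_cast hlen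
  omega
end

section
/- For all integers d ≥ 1 and t ≥ 1, every vertex-weighted undirected planar graph with maximum degree at most d has a (t, ⌈K/2⌉^{4t})-trimming, where K = (54t-29)d(d+1) - 1. Hence every family of planar graphs of bounded degree is trimmable. -/
open scoped Classical

/-- Planarity, via a straight-line plane embedding (equivalent to planarity for finite
simple graphs by Fáry's theorem): vertex-disjoint edges have disjoint segments,
edges sharing an endpoint meet exactly in it, and no vertex lies on the segment of an
edge not incident to it. -/
def IsPlanarStraight {V : Type} (G : SimpleGraph V) : Prop :=
  ∃ f : V → ℝ × ℝ, Function.Injective f ∧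
    (∀ a b c d : V, G.Adj a b → G.Adj c d → ({a, b} : Set V) ∩ {c, d} = ∅ →
      segment ℝ (f a) (f b) ∩ segment ℝ (f c) (f d) = ∅) ∧
    (∀ a b c : V, G.Adj a b → G.Adj a c → b ≠ c →
      segment ℝ (f a) (f b) ∩ segment ℝ (f a) (f c) = {f a}) ∧
    (∀ a b v : V, G.Adj a b → v ≠ a → v ≠ b → f v ∉ segment ℝ (f a) (f b))


/-- height of the line through `a`, `b` at abscissa `z` -/
noncomputable def ln (a b : ℝ × ℝ) (z : ℝ) : ℝ := a.2 + (z - a.1) * ((b.2 - a.2) / (b.1 - a.1))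

lemma ln_left (a b : ℝ × ℝ) : ln a b a.1 = a.2 := by simp [ln]

lemma ln_right (a b : ℝ × ℝ) (h : a.1 ≠ b.1) : ln a b b.1 = b.2 := by
  have : b.1 - a.1 ≠ 0 := sub_ne_zero.mpr h.symm
  unfold ln; field_simp; ring

lemma ln_symm (a b : ℝ × ℝ) (h : a.1 ≠ b.1) (z : ℝ) : ln a b z = ln b a z := by
  have h1 : b.1 - a.1 ≠ 0 := sub_ne_zero.mpr h.symm
  have h2 : a.1 - b.1 ≠ 0 := sub_ne_zero.mpr h
  unfold ln; field_simp; ring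

lemma ln_sub (a b : ℝ × ℝ) (x : ℝ) (h : a.1 ≠ x) (z : ℝ) :
    ln a (x, ln a b x) z = ln a b z := by
  have h1 : x - a.1 ≠ 0 := sub_ne_zero.mpr h.symm
  unfold ln; simp only; field_simp; ring

lemma ln_mem (a b : ℝ × ℝ) (z : ℝ) (hab : a.1 < b.1) (h1 : a.1 ≤ z) (h2 : z ≤ b.1) :
    (z, ln a b z) ∈ segment ℝ a b := by
  have h : 0 < b.1 - a.1 := by linarith
  rw [segment_eq_image]
  refine ⟨(z - a.1) / (b.1 - a.1), ⟨by apply div_nonneg <;> linarith, by rw [div_le_one h]; linarith⟩, ?_⟩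
  ext
  · simp; field_simp; ring
  · simp [ln]; field_simp; ring

lemma ln_cont (a b : ℝ × ℝ) : Continuous (ln a b) := by unfold ln; fun_prop

/-- same sign -/
lemma ln_sign (a b c d : ℝ × ℝ) (z₁ z₂ : ℝ) (h : ∀ z, min z₁ z₂ ≤ z → z ≤ max z₁ z₂ → ln a b z ≠ ln c d z)
    (h1 : ln a b z₁ < ln c d z₁) : ln a b z₂ < ln c d z₂ := by
  by_contra hc
  push Not at hc
  have hcont : ContinuousOn (fun z => ln c d z - ln a b z) (Set.uIcc z₁ z₂) :=
    ((ln_cont c d).sub (ln_cont a b)).continuousOn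
  have := intermediate_value_uIcc hcont
  have hm : (0:ℝ) ∈ Set.uIcc (ln c d z₁ - ln a b z₁) (ln c d z₂ - ln a b z₂) := by
    rw [Set.mem_uIcc]; right; constructor <;> linarith
  obtain ⟨z, hz, hz0⟩ := this hm
  rw [Set.uIcc, Set.mem_Icc] at hz
  exact h z hz.1 hz.2 (by simp only at hz0; linarith)

/-- strictly between -/
def xbtw (a b x : ℝ) : Prop := (a < x ∧ x < b) ∨ (b < x ∧ x < a)

lemma xbtw_symm (a b x : ℝ) : xbtw a b x ↔ xbtw b a x := by unfold xbtw; tauto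

def below (a b p : ℝ × ℝ) : Prop := xbtw a.1 b.1 p.1 ∧ p.2 < ln a b p.1
def above (a b p : ℝ × ℝ) : Prop := xbtw a.1 b.1 p.1 ∧ ln a b p.1 < p.2

lemma below_symm (a b p : ℝ × ℝ) : below a b p ↔ below b a p := by
  unfold below; rw [xbtw_symm]
  constructor
  · rintro ⟨h, h2⟩
    have : b.1 ≠ a.1 := by rintro h3; rw [h3] at h; unfold xbtw at h; rcases h with h | h <;> linarith
    exact ⟨h, by rwa [ln_symm b a this]⟩
  · rintro ⟨h, h2⟩
    have : b.1 ≠ a.1 := by rintro h3; rw [h3] at h; unfold xbtw at h; rcases h with h | h <;> linarith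
    exact ⟨h, by rwa [← ln_symm b a this]⟩

lemma above_symm (a b p : ℝ × ℝ) : above a b p ↔ above b a p := by
  unfold above; rw [xbtw_symm]
  constructor
  · rintro ⟨h, h2⟩
    have : b.1 ≠ a.1 := by rintro h3; rw [h3] at h; unfold xbtw at h; rcases h with h | h <;> linarith
    exact ⟨h, by rwa [ln_symm b a this]⟩
  · rintro ⟨h, h2⟩
    have : b.1 ≠ a.1 := by rintro h3; rw [h3] at h; unfold xbtw at h; rcases h with h | h <;> linarith
    exact ⟨h, by rwa [← ln_symm b a this]⟩

lemma four_aux (a b c d : ℝ × ℝ) (hab : a.1 < b.1) (hcd : c.1 < d.1)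
    (hac : a.1 ≠ c.1) (had : a.1 ≠ d.1) (hbc : b.1 ≠ c.1) (hbd : b.1 ≠ d.1)
    (h : ∀ z, a.1 ≤ z → z ≤ b.1 → c.1 ≤ z → z ≤ d.1 → ln a b z ≠ ln c d z) :
    (decide (above c d a) ^^ decide (above c d b)) = (decide (below a b c) ^^ decide (below a b d)) := by
  have hs : ∀ z₁ z₂, a.1 ≤ z₁ → z₁ ≤ b.1 → c.1 ≤ z₁ → z₁ ≤ d.1 → a.1 ≤ z₂ → z₂ ≤ b.1 → c.1 ≤ z₂ → z₂ ≤ d.1 →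
      (ln c d z₁ < ln a b z₁ ↔ ln c d z₂ < ln a b z₂) := by
    intro z₁ z₂ h1 h2 h3 h4 h5 h6 h7 h8
    constructor
    · apply ln_sign
      intro z hz1 hz2
      exact (h z (le_trans (le_min h1 h5) hz1) (le_trans hz2 (max_le h2 h6)) (le_trans (le_min h3 h7) hz1)
        (le_trans hz2 (max_le h4 h8))).symm
    · apply ln_sign
      intro z hz1 hz2
      exact (h z (le_trans (le_min h5 h1) hz1) (le_trans hz2 (max_le h6 h2)) (le_trans (le_min h7 h3) hz1)
        (le_trans hz2 (max_le h8 h4))).symm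
  have ea := ln_left a b
  have eb := ln_right a b hab.ne
  have ec := ln_left c d
  have ed := ln_right c d hcd.ne
  have e1 : above c d a ↔ (c.1 < a.1 ∧ a.1 < d.1) ∧ ln c d a.1 < ln a b a.1 := by
    unfold above xbtw; rw [ea]
    constructor
    · rintro ⟨h | h, h2⟩
      · exact ⟨h, h2⟩
      · linarith
    · rintro ⟨h, h2⟩; exact ⟨Or.inl h, h2⟩
  have e2 : above c d b ↔ (c.1 < b.1 ∧ b.1 < d.1) ∧ ln c d b.1 < ln a b b.1 := by
    unfold above xbtw; rw [eb]
    constructor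
    · rintro ⟨h | h, h2⟩
      · exact ⟨h, h2⟩
      · linarith
    · rintro ⟨h, h2⟩; exact ⟨Or.inl h, h2⟩
  have e3 : below a b c ↔ (a.1 < c.1 ∧ c.1 < b.1) ∧ ln c d c.1 < ln a b c.1 := by
    unfold below xbtw; rw [ec]
    constructor
    · rintro ⟨h | h, h2⟩
      · exact ⟨h, h2⟩
      · linarith
    · rintro ⟨h, h2⟩; exact ⟨Or.inl h, h2⟩
  have e4 : below a b d ↔ (a.1 < d.1 ∧ d.1 < b.1) ∧ ln c d d.1 < ln a b d.1 := by
    unfold below xbtw; rw [ed]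
    constructor
    · rintro ⟨h | h, h2⟩
      · exact ⟨h, h2⟩
      · linarith
    · rintro ⟨h, h2⟩; exact ⟨Or.inl h, h2⟩
  simp only [e1, e2, e3, e4]
  rcases lt_or_gt_of_ne hac with hac | hac <;> rcases lt_or_gt_of_ne had with had | had <;>
  rcases lt_or_gt_of_ne hbc with hbc | hbc <;> rcases lt_or_gt_of_ne hbd with hbd | hbd <;>
  first
  | (exfalso; linarith)
  | (simp only [hac, had, hbc, hbd, hac.not_gt, had.not_gt, hbc.not_gt, hbd.not_gt, true_and, and_true, false_and, and_false, and_self, decide_false, Bool.xor_false, Bool.false_xor]; done)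
  | (have hh := hs a.1 b.1 (by linarith) (by linarith) (by linarith) (by linarith) (by linarith) (by linarith) (by linarith) (by linarith)
     simp only [hac, had, hbc, hbd, hac.not_gt, had.not_gt, hbc.not_gt, hbd.not_gt, true_and, and_true, false_and, and_false, and_self, decide_false, Bool.xor_false, Bool.false_xor]
     simp [hh]; done)
  | (have hh := hs a.1 d.1 (by linarith) (by linarith) (by linarith) (by linarith) (by linarith) (by linarith) (by linarith) (by linarith)
     simp only [hac, had, hbc, hbd, hac.not_gt, had.not_gt, hbc.not_gt, hbd.not_gt, true_and, and_true, false_and, and_false, and_self, decide_false, Bool.xor_false, Bool.false_xor]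
     simp [hh]; done)
  | (have hh := hs c.1 b.1 (by linarith) (by linarith) (by linarith) (by linarith) (by linarith) (by linarith) (by linarith) (by linarith)
     simp only [hac, had, hbc, hbd, hac.not_gt, had.not_gt, hbc.not_gt, hbd.not_gt, true_and, and_true, false_and, and_false, and_self, decide_false, Bool.xor_false, Bool.false_xor]
     simp [hh]; done)
  | (have hh := hs c.1 d.1 (by linarith) (by linarith) (by linarith) (by linarith) (by linarith) (by linarith) (by linarith) (by linarith)
     simp only [hac, had, hbc, hbd, hac.not_gt, had.not_gt, hbc.not_gt, hbd.not_gt, true_and, and_true, false_and, and_false, and_self, decide_false, Bool.xor_false, Bool.false_xor]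
     simp [hh]; done)

/-- in-range predicate (closed) -/
def rng (a b z : ℝ) : Prop := min a b ≤ z ∧ z ≤ max a b

lemma four (a b c d : ℝ × ℝ) (hab : a.1 ≠ b.1) (hcd : c.1 ≠ d.1)
    (hac : a.1 ≠ c.1) (had : a.1 ≠ d.1) (hbc : b.1 ≠ c.1) (hbd : b.1 ≠ d.1)
    (h : ∀ z, rng a.1 b.1 z → rng c.1 d.1 z → ln a b z ≠ ln c d z) :
    (decide (above c d a) ^^ decide (above c d b)) = (decide (below a b c) ^^ decide (below a b d)) := by
  rcases lt_or_gt_of_ne hab with hab' | hab' <;> rcases lt_or_gt_of_ne hcd with hcd' | hcd'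
  · apply four_aux a b c d hab' hcd' hac had hbc hbd
    intro z h1 h2 h3 h4
    exact h z ⟨by simp [h1], by simp [h2]⟩ ⟨by simp [h3], by simp [h4]⟩
  · have := four_aux a b d c hab' hcd' had hac hbd hbc (by
      intro z h1 h2 h3 h4
      rw [ln_symm d c hcd.symm]
      exact h z ⟨by simp [h1], by simp [h2]⟩ ⟨by simp [h3], by simp [h4]⟩)
    simp only [above_symm c d]; rw [this, Bool.xor_comm]
  · have := four_aux b a c d hab' hcd' hbc hbd hac had (by
      intro z h1 h2 h3 h4
      rw [ln_symm b a hab.symm]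
      exact h z ⟨by simp [h1], by simp [h2]⟩ ⟨by simp [h3], by simp [h4]⟩)
    simp only [below_symm a b]; rw [← this, Bool.xor_comm]
  · have := four_aux b a d c hab' hcd' hbd hbc had hac (by
      intro z h1 h2 h3 h4
      rw [ln_symm b a hab.symm, ln_symm d c hcd.symm]
      exact h z ⟨by simp [h1], by simp [h2]⟩ ⟨by simp [h3], by simp [h4]⟩)
    simp only [below_symm a b, above_symm c d]; rw [Bool.xor_comm, this, Bool.xor_comm]


structure Drw {V : Type} (G : SimpleGraph V) (f : V → ℝ × ℝ) : Prop where
  inj : ∀ u v, (f u).1 = (f v).1 → u = v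
  dis : ∀ a b c d, G.Adj a b → G.Adj c d → a ≠ c → a ≠ d → b ≠ c → b ≠ d →
    ∀ p, p ∈ segment ℝ (f a) (f b) → p ∈ segment ℝ (f c) (f d) → False
  sh : ∀ a b c, G.Adj a b → G.Adj a c → b ≠ c →
    ∀ p, p ∈ segment ℝ (f a) (f b) → p ∈ segment ℝ (f a) (f c) → p = f a
  off : ∀ a b v, G.Adj a b → v ≠ a → v ≠ b → f v ∉ segment ℝ (f a) (f b)

lemma ln_mem' (a b : ℝ × ℝ) (z : ℝ) (hab : a.1 ≠ b.1) (h : rng a.1 b.1 z) :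
    (z, ln a b z) ∈ segment ℝ a b := by
  rcases lt_or_gt_of_ne hab with h1 | h1
  · apply ln_mem _ _ _ h1
    · simpa [h1.le] using h.1
    · simpa [h1.le] using h.2
  · rw [segment_symm, ln_symm a b hab]
    apply ln_mem _ _ _ h1
    · simpa [h1.le] using h.1
    · simpa [h1.le] using h.2

lemma Drw.ln_ne_dis {V : Type} {G : SimpleGraph V} {f : V → ℝ × ℝ} (D : Drw G f) {a b c e : V}
    (hab : G.Adj a b) (hce : G.Adj c e) (h1 : a ≠ c) (h2 : a ≠ e) (h3 : b ≠ c) (h4 : b ≠ e) (z : ℝ)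
    (hz : rng (f a).1 (f b).1 z) (hz' : rng (f c).1 (f e).1 z) :
    ln (f a) (f b) z ≠ ln (f c) (f e) z := by
  intro h
  have m1 := ln_mem' (f a) (f b) z (fun h => hab.ne (D.inj _ _ h)) hz
  have m2 := ln_mem' (f c) (f e) z (fun h => hce.ne (D.inj _ _ h)) hz'
  rw [← h] at m2
  exact D.dis a b c e hab hce h1 h2 h3 h4 _ m1 m2

lemma Drw.ln_ne {V : Type} {G : SimpleGraph V} {f : V → ℝ × ℝ} (D : Drw G f) {a b c e : V}
    (hab : G.Adj a b) (hce : G.Adj c e) (hX : (f c).1 < (f e).1) (hne : (a, b) ≠ (c, e)) (z : ℝ)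
    (h1 : (f a).1 < z) (h2 : z < (f b).1) (h3 : (f c).1 ≤ z) (h4 : z ≤ (f e).1) :
    ln (f a) (f b) z ≠ ln (f c) (f e) z := by
  intro h
  have m1 := ln_mem (f a) (f b) z (h1.trans h2) h1.le h2.le
  have m2 := ln_mem (f c) (f e) z hX h3 h4
  rw [← h] at m2
  by_cases e1 : a = c
  · subst e1
    have := D.sh a b e hab hce (by rintro rfl; exact hne rfl) _ m1 m2
    rw [← this] at h1; simp at h1
  by_cases e2 : b = e
  · subst e2
    rw [segment_symm] at m1 m2
    have := D.sh b a c hab.symm hce.symm e1 _ m1 m2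
    rw [← this] at h2; simp at h2
  by_cases e3 : a = e
  · subst e3; linarith
  by_cases e4 : b = c
  · subst e4; linarith
  exact D.dis a b c e hab hce e1 e3 e4 e2 _ m1 m2

abbrev Itm (V : Type) := Option (Option (V × V))

def act {V : Type} (G : SimpleGraph V) (f : V → ℝ × ℝ) (x : ℝ) : Itm V → Prop
  | none => True
  | some none => True
  | some (some (u, v)) => G.Adj u v ∧ (f u).1 < x ∧ x < (f v).1

def cact {V : Type} (G : SimpleGraph V) (f : V → ℝ × ℝ) (x : ℝ) : Itm V → Prop
  | none => True
  | some none => True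
  | some (some (u, v)) => G.Adj u v ∧ (f u).1 < (f v).1 ∧ (f u).1 ≤ x ∧ x ≤ (f v).1

noncomputable def ht {V : Type} (f : V → ℝ × ℝ) (x : ℝ) : Itm V → EReal
  | none => ⊥
  | some none => ⊤
  | some (some (u, v)) => ((ln (f u) (f v) x : ℝ) : EReal)

noncomputable def FF {V : Type} (f : V → ℝ × ℝ) (J : V → V → Bool) (x : ℝ) : Itm V → V → Bool
  | none => fun _ => false
  | some none => fun y => decide ((f y).1 < x)
  | some (some (u, v)) => fun y => J u y ^^ decide (below (f u) (x, ln (f u) (f v) x) (f y))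

noncomputable def TT {V : Type} : Itm V → Finset V
  | none => ∅
  | some none => ∅
  | some (some (u, v)) => {u, v}

lemma act.cact {V : Type} {G : SimpleGraph V} {f : V → ℝ × ℝ} {x : ℝ} {i : Itm V} (h : act G f x i) :
    cact G f x i := by
  rcases i with _ | _ | ⟨u, v⟩
  · trivial
  · trivial
  · exact ⟨h.1, h.2.1.trans h.2.2, h.2.1.le, h.2.2.le⟩

lemma ht_ne {V : Type} {G : SimpleGraph V} {f : V → ℝ × ℝ} (D : Drw G f) {z : ℝ} {i k : Itm V}
    (hi : act G f z i) (hk : cact G f z k) (hne : i ≠ k) : ht f z i ≠ ht f z k := by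
  rcases i with _ | _ | ⟨a, b⟩ <;> rcases k with _ | _ | ⟨c, e⟩ <;> simp [ht] at hne ⊢
  exact D.ln_ne hi.1 hk.1 hk.2.1 (by simpa using hne) z hi.2.1 hi.2.2 hk.2.2.1 hk.2.2.2

lemma ht_mono {V : Type} {G : SimpleGraph V} {f : V → ℝ × ℝ} (D : Drw G f) {z₁ z₂ : ℝ} {i k : Itm V}
    (hi₁ : act G f z₁ i) (hi₂ : act G f z₂ i) (hk₁ : cact G f z₁ k) (hk₂ : cact G f z₂ k) (hne : i ≠ k) :
    (ht f z₁ i < ht f z₁ k ↔ ht f z₂ i < ht f z₂ k) ∧ (ht f z₁ k < ht f z₁ i ↔ ht f z₂ k < ht f z₂ i) := by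
  rcases i with _ | _ | ⟨a, b⟩ <;> rcases k with _ | _ | ⟨c, e⟩ <;> simp [ht] at hne ⊢
  have key : ∀ z, min z₁ z₂ ≤ z → z ≤ max z₁ z₂ → ln (f a) (f b) z ≠ ln (f c) (f e) z := by
    intro z h1 h2
    refine D.ln_ne hi₁.1 hk₁.1 hk₁.2.1 (by simpa using hne) z ?_ ?_ ?_ ?_
    · exact lt_of_lt_of_le (lt_min hi₁.2.1 hi₂.2.1) h1
    · exact lt_of_le_of_lt h2 (max_lt hi₁.2.2 hi₂.2.2)
    · exact le_trans (le_min hk₁.2.2.1 hk₂.2.2.1) h1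
    · exact le_trans h2 (max_le hk₁.2.2.2 hk₂.2.2.2)
  have key' : ∀ z, min z₂ z₁ ≤ z → z ≤ max z₂ z₁ → ln (f a) (f b) z ≠ ln (f c) (f e) z := by
    intro z h1 h2; exact key z (min_comm z₂ z₁ ▸ h1) (max_comm z₂ z₁ ▸ h2)
  exact ⟨⟨ln_sign _ _ _ _ _ _ key, ln_sign _ _ _ _ _ _ key'⟩,
    ⟨ln_sign _ _ _ _ _ _ (fun z a b => (key z a b).symm), ln_sign _ _ _ _ _ _ (fun z a b => (key' z a b).symm)⟩⟩

lemma FF_edge {V : Type} {G : SimpleGraph V} {f : V → ℝ × ℝ} (D : Drw G f)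
    (P : V → Set V) (J : V → V → Bool) (hP : ∀ u, u ∈ P u)
    (hJ : ∀ u, (∃ u', G.Adj u u') → ∀ v w, G.Adj v w → v ∉ P u → w ∉ P u →
      (J u v ^^ J u w) = decide (above (f v) (f w) (f u)))
    {x : ℝ} (hx : ∀ v, (f v).1 ≠ x) {i : Itm V} (hi : act G f x i) {v w : V} (hvw : G.Adj v w)
    (hv : ∀ u ∈ TT i, v ∉ P u) (hw : ∀ u ∈ TT i, w ∉ P u) :
    (FF f J x i v ^^ FF f J x i w) =
      decide (xbtw (f v).1 (f w).1 x ∧ ((ln (f v) (f w) x : ℝ) : EReal) < ht f x i) := by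
  have hvx := hx v
  have hwx := hx w
  rcases i with _ | _ | ⟨a, b⟩
  · simp [FF, ht]
  · simp only [FF, ht, EReal.coe_lt_top, and_true]
    unfold xbtw
    rcases lt_or_gt_of_ne hvx with h1 | h1 <;> rcases lt_or_gt_of_ne hwx with h2 | h2 <;>
      simp [h1, h2, h1.not_gt, h2.not_gt]
  · have hab : G.Adj a b := hi.1
    have hva := hv a (by simp [TT])
    have hwa := hw a (by simp [TT])
    have hvb : b ≠ v := by rintro rfl; exact hv b (by simp [TT]) (hP b)
    have hwb : b ≠ w := by rintro rfl; exact hw b (by simp [TT]) (hP b)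
    have hva' : a ≠ v := by rintro rfl; exact hva (hP a)
    have hwa' : a ≠ w := by rintro rfl; exact hwa (hP a)
    have e1 := hJ a ⟨b, hab⟩ v w hvw hva hwa
    have e2 := four (f a) (x, ln (f a) (f b) x) (f v) (f w) hi.2.1.ne (fun h => hvw.ne (D.inj _ _ h))
      (fun h => hva' (D.inj _ _ h)) (fun h => hwa' (D.inj _ _ h)) (hx v).symm (hx w).symm (by
        intro z h1 h2
        rw [ln_sub _ _ _ hi.2.1.ne]
        refine D.ln_ne_dis hab hvw hva' hwa' hvb hwb z ?_ h2
        have h3 := hi.2.1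
        have h4 := hi.2.2
        unfold rng at h1 ⊢
        simp only [h3.le, (h3.trans h4).le, min_eq_left, max_eq_right] at h1 ⊢
        exact ⟨h1.1, by linarith [h1.2]⟩)
    have e3 : decide (xbtw (f v).1 (f w).1 x ∧ ((ln (f v) (f w) x : ℝ) : EReal) < ht f x (some (some (a, b))))
      = decide (above (f v) (f w) (x, ln (f a) (f b) x)) := by
      rw [decide_eq_decide]; simp [ht, above]
    rw [e3]
    simp only [FF]
    revert e1 e2
    generalize decide (above (f v) (f w) (f a)) = q1
    generalize decide (above (f v) (f w) (x, ln (f a) (f b) x)) = q2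
    generalize decide (below _ _ (f v)) = q3
    generalize decide (below _ _ (f w)) = q4
    generalize J a v = q5
    generalize J a w = q6
    revert q1 q2 q3 q4 q5 q6
    decide

lemma FF_const {V : Type} {G : SimpleGraph V} {f : V → ℝ × ℝ} (D : Drw G f)
    (P : V → Set V) (J : V → V → Bool) (hP : ∀ u, u ∈ P u)
    (hJ : ∀ u, (∃ u', G.Adj u u') → ∀ v w, G.Adj v w → v ∉ P u → w ∉ P u →
      (J u v ^^ J u w) = decide (above (f v) (f w) (f u)))
    {x : ℝ} (hx : ∀ v, (f v).1 ≠ x) {i j : Itm V} (hi : act G f x i) (hj : act G f x j)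
    (hij : ht f x i < ht f x j) (hcon : ∀ k, act G f x k → ht f x i < ht f x k → ht f x k < ht f x j → False)
    {v w : V} (hvw : G.Adj v w)
    (hv : ∀ u ∈ TT i ∪ TT j, v ∉ P u) (hw : ∀ u ∈ TT i ∪ TT j, w ∉ P u) :
    (FF f J x i v ^^ FF f J x j v) = (FF f J x i w ^^ FF f J x j w) := by
  have e1 := FF_edge D P J hP hJ hx hi hvw (fun u hu => hv u (Finset.mem_union_left _ hu))
    (fun u hu => hw u (Finset.mem_union_left _ hu))
  have e2 := FF_edge D P J hP hJ hx hj hvw (fun u hu => hv u (Finset.mem_union_right _ hu))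
    (fun u hu => hw u (Finset.mem_union_right _ hu))
  have e3 : decide (xbtw (f v).1 (f w).1 x ∧ ((ln (f v) (f w) x : ℝ) : EReal) < ht f x i) =
     decide (xbtw (f v).1 (f w).1 x ∧ ((ln (f v) (f w) x : ℝ) : EReal) < ht f x j) := by
    rw [decide_eq_decide]
    apply and_congr_right
    intro hb
    -- the item of the edge vw
    obtain ⟨a, b, hab, hk, hh⟩ : ∃ a b, (a = v ∧ b = w ∨ a = w ∧ b = v) ∧ act G f x (some (some (a, b))) ∧
        ((ln (f v) (f w) x : ℝ) : EReal) = ht f x (some (some (a, b))) := by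
      rcases hb with hb | hb
      · exact ⟨v, w, Or.inl ⟨rfl, rfl⟩, ⟨hvw, hb⟩, rfl⟩
      · refine ⟨w, v, Or.inr ⟨rfl, rfl⟩, ⟨hvw.symm, hb⟩, ?_⟩
        simp only [ht]; rw [ln_symm]; exact (hb.1.trans hb.2).ne'
    rw [hh]
    have hav : a ∉ TT i ∪ TT j := by
      intro ha
      rcases hab with ⟨rfl, rfl⟩ | ⟨rfl, rfl⟩
      · exact hv _ ha (hP _)
      · exact hw _ ha (hP _)
    have hni : i ≠ some (some (a, b)) := by
      rintro rfl; exact hav (by simp [TT])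
    have hnj : j ≠ some (some (a, b)) := by
      rintro rfl; exact hav (by simp [TT])
    have n1 := ht_ne D hi hk.cact hni
    have n2 := ht_ne D hj hk.cact hnj
    constructor
    · intro h; exact h.trans hij
    · intro h
      rcases lt_or_gt_of_ne n1 with h1 | h1
      · exact (hcon _ hk h1 h).elim
      · exact h1
  rw [e3] at e1
  rw [← e2] at e1
  revert e1
  generalize FF f J x i v = q1
  generalize FF f J x i w = q2
  generalize FF f J x j v = q3
  generalize FF f J x j w = q4
  revert q1 q2 q3 q4
  decide


def SwInv {V : Type} (G : SimpleGraph V) (f : V → ℝ × ℝ) (J : V → V → Bool) (β : Finset V → Set V)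
    (x : ℝ) (φ : Itm V → Bool) : Prop :=
  φ none = false ∧ φ (some none) = false ∧
  ∀ i j, act G f x i → act G f x j → ht f x i < ht f x j →
    (∀ k, act G f x k → ht f x i < ht f x k → ht f x k < ht f x j → False) →
    ∀ y ∈ β (TT i ∪ TT j), (φ i ^^ φ j) = (FF f J x i y ^^ FF f J x j y)

/-- unaffected away from v -/
lemma FF_same {V : Type} {G : SimpleGraph V} {f : V → ℝ × ℝ} (J : V → V → Bool)
    {x x' : ℝ} {v : V} (hxx : x < x')
    (hgap : ∀ u, u ≠ v → (f u).1 < x ∨ x' < (f u).1) {i : Itm V} (hi : act G f x i)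
    {y : V} (hy : y ≠ v) : FF f J x i y = FF f J x' i y := by
  rcases i with _ | _ | ⟨a, b⟩
  · rfl
  · simp only [FF]; rw [decide_eq_decide]
    rcases hgap y hy with h | h
    · simp [h, h.trans hxx]
    · simp [h.not_gt, (hxx.trans h).not_gt]
  · simp only [FF]
    congr 1
    rw [decide_eq_decide]
    unfold below
    have h0 := hi.2.1
    rw [ln_sub _ _ _ h0.ne, ln_sub _ _ _ (h0.trans hxx).ne]
    unfold xbtw
    rcases hgap y hy with h | h
    · simp [h, h.trans hxx, h.not_gt, (h.trans hxx).not_gt]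
    · constructor
      · rintro ⟨h | h, _⟩ <;> dsimp only at h <;> linarith [h.1, h.2]
      · rintro ⟨h | h, _⟩ <;> dsimp only at h <;> linarith [h.1, h.2]

/-- effect at v -/
lemma FF_at {V : Type} {G : SimpleGraph V} {f : V → ℝ × ℝ} (J : V → V → Bool)
    {x x' : ℝ} {v : V} (h1 : x < (f v).1) (h2 : (f v).1 < x')
    {i : Itm V} (hi : act G f x i) :
    (FF f J x i v ^^ FF f J x' i v) = decide ((((f v).2 : ℝ) : EReal) < ht f (f v).1 i) := by
  rcases i with _ | _ | ⟨a, b⟩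
  · simp [FF, ht]
  · simp [FF, ht, h2, h1.le]
  · have h0 := hi.2.1
    have e1 : decide (below (f a) (x, ln (f a) (f b) x) (f v)) = false := by
      rw [decide_eq_false_iff_not]
      unfold below xbtw
      rintro ⟨h | h, _⟩ <;> simp at h <;> linarith
    have e2 : decide (below (f a) (x', ln (f a) (f b) x') (f v)) = decide ((((f v).2 : ℝ) : EReal) < ht f (f v).1 (some (some (a, b)))) := by
      rw [decide_eq_decide]
      unfold below xbtw
      rw [ln_sub _ _ _ (h0.trans (h1.trans h2)).ne]
      simp [ht, h0.trans h1, h2]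
    simp only [FF, e1, e2]
    cases J a v <;> simp

lemma sweep_step {V : Type} [Fintype V] {G : SimpleGraph V} {f : V → ℝ × ℝ} (D : Drw G f)
    (P : V → Set V) (J : V → V → Bool) (hP : ∀ u, u ∈ P u)
    (hJ : ∀ u, (∃ u', G.Adj u u') → ∀ v w, G.Adj v w → v ∉ P u → w ∉ P u →
      (J u v ^^ J u w) = decide (above (f v) (f w) (f u)))
    (d : ℕ) (hd : ∀ v, (Finset.univ.filter (G.Adj v)).card ≤ d)
    (β : Finset V → Set V) (hanti : ∀ S T, S ⊆ T → β T ⊆ β S)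
    (hne : ∀ T, T.card ≤ d + 5 → (β T).Nonempty) (hoff : ∀ T, ∀ y ∈ β T, y ∉ T)
    (hc : ∀ T, ∀ g : V → Bool, (∀ v w, G.Adj v w → (∀ u ∈ T, v ∉ P u) → (∀ u ∈ T, w ∉ P u) → g v = g w) →
      ∀ y ∈ β T, ∀ y' ∈ β T, g y = g y')
    {x x' : ℝ} {v : V} (h1 : x < (f v).1) (h2 : (f v).1 < x')
    (hgap : ∀ u, u ≠ v → (f u).1 < x ∨ x' < (f u).1)
    (φ : Itm V → Bool) (hφ : SwInv G f J β x φ) : ∃ φ', SwInv G f J β x' φ' := by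
  have hxx : x < x' := h1.trans h2
  obtain ⟨hφ0, hφ1, hφ⟩ := hφ
  have hx' : ∀ u, (f u).1 ≠ x' := by
    intro u
    by_cases hu : u = v
    · subst hu; exact h2.ne
    · rcases hgap u hu with h | h
      · exact (h.trans hxx).ne
      · exact h.ne'
  set z := (f v).1 with hz
  set yv : EReal := (((f v).2 : ℝ) : EReal) with hyv
  -- classification
  have hL : ∀ k, act G f x k → act G f x' k ∨ (ht f z k = yv ∧ TT k ⊆ insert v (Finset.univ.filter (G.Adj v))) := by
    intro k hk
    rcases k with _ | _ | ⟨a, b⟩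
    · left; trivial
    · left; trivial
    · by_cases hb : b = v
      · right
        subst hb
        constructor
        · simp only [ht, hyv, hz]; rw [ln_right]; exact (hk.2.1.trans hk.2.2).ne
        · intro u; simp [TT]; rintro (rfl | rfl)
          · right; exact hk.1.symm
          · left; rfl
      · left
        refine ⟨hk.1, hk.2.1.trans hxx, ?_⟩
        rcases hgap b hb with h | h
        · exact absurd hk.2.2 h.not_gt
        · exact h
  have hR : ∀ k, act G f x' k → act G f x k ∨ (ht f z k = yv ∧ TT k ⊆ insert v (Finset.univ.filter (G.Adj v))) := by
    intro k hk
    rcases k with _ | _ | ⟨a, b⟩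
    · left; trivial
    · left; trivial
    · by_cases hb : a = v
      · right
        subst hb
        constructor
        · simp only [ht, hyv, hz]; rw [ln_left]
        · intro u; simp [TT]; rintro (rfl | rfl)
          · left; rfl
          · right; exact hk.1
      · left
        refine ⟨hk.1, ?_, hxx.trans hk.2.2⟩
        rcases hgap a hb with h | h
        · exact h
        · exact absurd hk.2.1 h.not_gt
  have hcz : ∀ k, act G f x k → cact G f z k := by
    intro k hk
    rcases k with _ | _ | ⟨a, b⟩
    · trivial
    · trivial
    · refine ⟨hk.1, hk.2.1.trans hk.2.2, (hk.2.1.trans h1).le, ?_⟩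
      by_cases hb : b = v
      · subst hb; exact le_rfl
      · rcases hgap b hb with h | h
        · exact absurd hk.2.2 h.not_gt
        · exact (h2.trans h).le
  have hcz' : ∀ k, act G f x' k → cact G f z k := by
    intro k hk
    rcases k with _ | _ | ⟨a, b⟩
    · trivial
    · trivial
    · refine ⟨hk.1, hk.2.1.trans hk.2.2, ?_, (h2.trans hk.2.2).le⟩
      by_cases hb : a = v
      · subst hb; exact le_rfl
      · rcases hgap a hb with h | h
        · exact (h.trans h1).le
        · exact absurd hk.2.1 h.not_gt
  have haz : ∀ k, act G f x k → act G f x' k → act G f z k := by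
    intro k hk hk'
    rcases k with _ | _ | ⟨a, b⟩
    · trivial
    · trivial
    · exact ⟨hk.1, hk.2.1.trans h1, h2.trans hk'.2.2⟩
  have hcne : ∀ k, act G f x k → act G f x' k → ht f z k ≠ yv := by
    intro k hk hk' he
    rcases k with _ | _ | ⟨a, b⟩
    · simp [ht, hyv] at he
    · simp [ht, hyv] at he
    · simp only [ht, hyv, EReal.coe_eq_coe_iff] at he
      have ha : v ≠ a := by rintro rfl; exact absurd hk.2.1 h1.not_gt
      have hb : v ≠ b := by rintro rfl; exact absurd hk'.2.2 h2.not_gt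
      have := ln_mem (f a) (f b) z (hk.2.1.trans hk.2.2) (hk.2.1.trans h1).le (h2.trans hk'.2.2).le
      rw [he] at this
      exact D.off a b v hk.1 ha hb this
  -- order transfer
  have oL : ∀ i k, act G f x i → act G f x' i → act G f x k → i ≠ k →
      (ht f x i < ht f x k ↔ ht f z i < ht f z k) ∧ (ht f x k < ht f x i ↔ ht f z k < ht f z i) :=
    fun i k a b c e => ht_mono D a (haz i a b) c.cact (hcz k c) e
  have oR : ∀ i k, act G f x i → act G f x' i → act G f x' k → i ≠ k →
      (ht f x' i < ht f x' k ↔ ht f z i < ht f z k) ∧ (ht f x' k < ht f x' i ↔ ht f z k < ht f z i) :=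
    fun i k a b c e => ht_mono D b (haz i a b) c.cact (hcz' k c) e
  -- neighbours of v above and below
  obtain ⟨em, hem, hemax⟩ := Finset.exists_max_image
    (Finset.univ.filter (fun i : Itm V => (act G f x i ∧ act G f x' i) ∧ ht f z i < yv)) (ht f z)
    ⟨none, by simp [act, ht, hyv]⟩
  obtain ⟨ep, hep, hemin⟩ := Finset.exists_min_image
    (Finset.univ.filter (fun i : Itm V => (act G f x i ∧ act G f x' i) ∧ yv < ht f z i)) (ht f z)
    ⟨some none, by simp [act, ht, hyv]⟩
  simp only [Finset.mem_filter, Finset.mem_univ, true_and] at hem hep hemax hemin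
  have hmp : ht f z em < ht f z ep := hem.2.trans hep.2
  have hempne : em ≠ ep := by rintro h; rw [h] at hmp; exact lt_irrefl _ hmp
  set Ts : Finset V := (TT em ∪ TT ep) ∪ insert v (Finset.univ.filter (G.Adj v)) with hTs
  have hTT : ∀ i : Itm V, (TT i).card ≤ 2 := by
    intro i
    rcases i with _ | _ | ⟨a, b⟩
    · simp [TT]
    · simp [TT]
    · exact Finset.card_le_two
  obtain ⟨ys, hys⟩ := hne Ts (by
    have a1 := Finset.card_union_le (TT em ∪ TT ep) (insert v (Finset.univ.filter (G.Adj v)))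
    have a2 := Finset.card_union_le (TT em) (TT ep)
    have a3 := Finset.card_insert_le v (Finset.univ.filter (G.Adj v))
    have := hd v
    have := hTT em
    have := hTT ep
    rw [hTs]
    omega)
  have hysv : ys ≠ v := by
    rintro rfl; exact hoff Ts _ hys (by simp [hTs])
  -- M x : the items em, ep and those at v
  have hTM : ∀ i, (i = em ∨ i = ep ∨ TT i ⊆ insert v (Finset.univ.filter (G.Adj v))) → TT i ⊆ Ts := by
    rintro i (rfl | rfl | h)
    · intro u hu; simp only [hTs, Finset.mem_union]; tauto
    · intro u hu; simp only [hTs, Finset.mem_union]; tauto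
    · intro u hu; have := h hu; simp only [hTs, Finset.mem_union]; tauto
  -- chain at x
  have chain : ∀ n : ℕ, ∀ i, act G f x i → (i = ep ∨ ht f z i = yv) →
      (Finset.univ.filter (fun k : Itm V => act G f x k ∧ ht f x k < ht f x i)).card = n →
      (φ i ^^ FF f J x i ys) = (φ em ^^ FF f J x em ys) := by
    intro n
    induction n using Nat.strong_induction_on with
    | _ n ih =>
      intro i hi hic hcard
      have hzi : ht f z em < ht f z i := by
        rcases hic with rfl | h
        · exact hmp
        · rw [h]; exact hem.2
      have hiem : em ≠ i := by rintro rfl; exact lt_irrefl _ hzi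
      have hxi : ht f x em < ht f x i := (oL em i hem.1.1 hem.1.2 hi hiem).1.mpr hzi
      obtain ⟨j, hj, hjmax⟩ := Finset.exists_max_image
        (Finset.univ.filter (fun k : Itm V => act G f x k ∧ ht f x k < ht f x i)) (ht f x)
        ⟨em, by simp [hem.1.1, hxi]⟩
      simp only [Finset.mem_filter, Finset.mem_univ, true_and] at hj hjmax
      have hjem : ht f x em ≤ ht f x j := hjmax em ⟨hem.1.1, hxi⟩
      have hiT : TT i ⊆ Ts := by
        apply hTM
        rcases hic with h | h
        · right; left; exact h
        · right; right
          rcases hL i hi with h' | h'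
          · exact absurd h (hcne i hi h')
          · exact h'.2
      -- classify j
      have hjM : j = em ∨ (j ≠ ep ∧ ht f z j = yv ∧ TT j ⊆ insert v (Finset.univ.filter (G.Adj v))) := by
        rcases hL j hj.1 with h' | h'
        · left
          by_contra hne'
          have hjz : ht f z em < ht f z j := by
            rcases hjem.lt_or_eq with h | h
            · exact (oL em j hem.1.1 hem.1.2 hj.1 (Ne.symm hne')).1.mp h
            · exact absurd h (ht_ne D hem.1.1 hj.1.cact (Ne.symm hne'))
          rcases lt_or_gt_of_ne (hcne j hj.1 h') with h | h
          · exact absurd (hemax j ⟨⟨hj.1, h'⟩, h⟩) (not_le.mpr hjz)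
          · have a1 := hemin j ⟨⟨hj.1, h'⟩, h⟩
            have a2 : ht f z j < ht f z i := (oL j i hj.1 h' hi (by rintro rfl; exact lt_irrefl _ hj.2)).1.mp hj.2
            have a3 : ht f z i ≤ ht f z ep := by
              rcases hic with rfl | h0
              · exact le_rfl
              · rw [h0]; exact hep.2.le
            exact absurd (a2.trans_le a3) (not_lt.mpr a1)
        · right
          refine ⟨?_, h'⟩
          rintro rfl
          exact hep.2.ne' h'.1
      have hjT : TT j ⊆ Ts := hTM j (by tauto)
      have e1 := hφ j i hj.1 hi hj.2 (fun k hk hk1 hk2 => absurd (hjmax k ⟨hk, hk2⟩) (not_le.mpr hk1)) ys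
        (hanti _ _ (Finset.union_subset hjT hiT) hys)
      have e2 : (φ j ^^ FF f J x j ys) = (φ em ^^ FF f J x em ys) := by
        rcases hjM with rfl | ⟨_, hjv, _⟩
        · rfl
        · refine ih _ ?_ j hj.1 (Or.inr hjv) rfl
          rw [← hcard]
          apply Finset.card_lt_card
          rw [Finset.ssubset_iff_of_subset]
          · exact ⟨j, by simp [hj], by simp⟩
          · intro k; simp only [Finset.mem_filter, Finset.mem_univ, true_and]
            rintro ⟨a, b⟩; exact ⟨a, b.trans hj.2⟩
      rw [← e2]
      revert e1
      generalize φ j = q1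
      generalize φ i = q2
      generalize FF f J x j ys = q3
      generalize FF f J x i ys = q4
      revert q1 q2 q3 q4
      decide
  have hepψ := chain _ ep hep.1.1 (Or.inl rfl) rfl
  refine ⟨fun i => if act G f x i then φ i else ((φ em ^^ FF f J x em ys) ^^ FF f J x' i ys), ?_, ?_, ?_⟩
  · simp [act, hφ0]
  · simp [act, hφ1]
  intro i j hi hj hij hcon y hy
  simp only
  -- old case
  have old : act G f x i → act G f x j → (yv < ht f z i ↔ yv < ht f z j) →
      (φ i ^^ φ j) = (FF f J x' i y ^^ FF f J x' j y) := by
    intro hi0 hj0 hs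
    have hnij : i ≠ j := by rintro rfl; exact lt_irrefl _ hij
    have hzij := (oR i j hi0 hi hj hnij).1.mp hij
    have e1 := hφ i j hi0 hj0 ((oL i j hi0 hi hj0 hnij).1.mpr hzij) (by
      intro k hk hk1 hk2
      have n1 : i ≠ k := by rintro rfl; exact lt_irrefl _ hk1
      have n2 : j ≠ k := by rintro rfl; exact lt_irrefl _ hk2
      have z1 := (oL i k hi0 hi hk n1).1.mp hk1
      have z2 := (oL j k hj0 hj hk n2).2.mp hk2
      rcases hL k hk with h' | h'
      · exact hcon k h' ((oR i k hi0 hi h' n1).1.mpr z1) ((oR j k hj0 hj h' n2).2.mpr z2)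
      · rw [h'.1] at z1 z2
        exact absurd (hs.mpr z2) z1.not_gt) y hy
    rw [e1]
    by_cases hyv' : y = v
    · subst hyv'
      have f1 := FF_at J h1 h2 hi0
      have f2 := FF_at J h1 h2 hj0
      have f3 : decide ((((f y).2 : ℝ) : EReal) < ht f (f y).1 i) = decide ((((f y).2 : ℝ) : EReal) < ht f (f y).1 j) := by
        rw [decide_eq_decide]; exact hs
      rw [f3, ← f2] at f1
      revert f1
      generalize FF f J x i y = q1
      generalize FF f J x' i y = q2
      generalize FF f J x j y = q3
      generalize FF f J x' j y = q4
      revert q1 q2 q3 q4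
      decide
    · rw [FF_same J hxx hgap hi0 hyv', FF_same J hxx hgap hj0 hyv']
  -- new case
  have new : (i = em ∨ i = ep ∨ ¬ act G f x i) → (j = em ∨ j = ep ∨ ¬ act G f x j) →
      ((if act G f x i then φ i else ((φ em ^^ FF f J x em ys) ^^ FF f J x' i ys)) ^^
       (if act G f x j then φ j else ((φ em ^^ FF f J x em ys) ^^ FF f J x' j ys))) =
      (FF f J x' i y ^^ FF f J x' j y) := by
    have aux : ∀ i, act G f x' i → (i = em ∨ i = ep ∨ ¬ act G f x i) → TT i ⊆ Ts ∧
        ((if act G f x i then φ i else ((φ em ^^ FF f J x em ys) ^^ FF f J x' i ys)) ^^ FF f J x' i ys)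
          = (φ em ^^ FF f J x em ys) := by
      rintro i hi (rfl | rfl | h)
      · refine ⟨hTM _ (by tauto), ?_⟩
        rw [if_pos hem.1.1, FF_same J hxx hgap hem.1.1 hysv]
      · refine ⟨hTM _ (by tauto), ?_⟩
        rw [if_pos hep.1.1, ← hepψ, FF_same J hxx hgap hep.1.1 hysv]
      · refine ⟨hTM _ ?_, ?_⟩
        · rcases hR i hi with h' | h'
          · exact absurd h' h
          · exact Or.inr (Or.inr h'.2)
        · rw [if_neg h]
          simp
    intro ci cj
    obtain ⟨t1, a1⟩ := aux i hi ci
    obtain ⟨t2, a2⟩ := aux j hj cj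
    have e1 := hc (TT i ∪ TT j) (fun y => FF f J x' i y ^^ FF f J x' j y)
      (fun v w hvw hv hw => FF_const D P J hP hJ hx' hi hj hij hcon hvw hv hw) y hy ys
      (hanti _ _ (Finset.union_subset t1 t2) hys)
    rw [e1]
    revert a1 a2
    generalize (if act G f x i then φ i else ((φ em ^^ FF f J x em ys) ^^ FF f J x' i ys)) = q1
    generalize (if act G f x j then φ j else ((φ em ^^ FF f J x em ys) ^^ FF f J x' j ys)) = q2
    generalize FF f J x' i ys = q3
    generalize FF f J x' j ys = q4
    generalize (φ em ^^ FF f J x em ys) = q5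
    revert q1 q2 q3 q4 q5
    decide
  have hnij : i ≠ j := by rintro rfl; exact lt_irrefl _ hij
  by_cases hi0 : act G f x i
  · rcases lt_or_gt_of_ne (hcne i hi0 hi) with hib | hia
    · by_cases hj0 : act G f x j
      · rcases lt_or_gt_of_ne (hcne j hj0 hj) with hjb | hja
        · rw [if_pos hi0, if_pos hj0]; apply old hi0 hj0; simp [hib.not_gt, hjb.not_gt]
        · apply new
          · left
            by_contra hne'
            have b1 := hemax i ⟨⟨hi0, hi⟩, hib⟩
            have b2 := ht_ne D (haz i hi0 hi) (hcz em hem.1.1) hne'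
            have b3 := (oR i em hi0 hi hem.1.2 hne').1.mpr (lt_of_le_of_ne b1 b2)
            exact hcon em hem.1.2 b3 ((oR em j hem.1.1 hem.1.2 hj (by rintro rfl; exact hja.not_gt hem.2)).1.mpr (hem.2.trans hja))
          · right; left
            by_contra hne'
            have b1 := hemin j ⟨⟨hj0, hj⟩, hja⟩
            have b2 := ht_ne D (haz j hj0 hj) (hcz ep hep.1.1) hne'
            have b3 := (oR j ep hj0 hj hep.1.2 hne').2.mpr (lt_of_le_of_ne b1 b2.symm)
            exact hcon ep hep.1.2 ((oR ep i hep.1.1 hep.1.2 hi (by rintro rfl; exact hib.not_gt hep.2)).2.mpr (hib.trans hep.2)) b3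
      · apply new
        · left
          by_contra hne'
          have b1 := hemax i ⟨⟨hi0, hi⟩, hib⟩
          have b2 := ht_ne D (haz i hi0 hi) (hcz em hem.1.1) hne'
          have b3 := (oR i em hi0 hi hem.1.2 hne').1.mpr (lt_of_le_of_ne b1 b2)
          have hjz : ht f z j = yv := (hR j hj).resolve_left hj0 |>.1
          exact hcon em hem.1.2 b3 ((oR em j hem.1.1 hem.1.2 hj (by rintro rfl; exact hj0 hem.1.1)).1.mpr (hjz ▸ hem.2))
        · right; right; exact hj0
    · have hzij := (oR i j hi0 hi hj hnij).1.mp hij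
      have hj0 : act G f x j := by
        rcases hR j hj with h | h
        · exact h
        · rw [h.1] at hzij; exact absurd hzij hia.not_gt
      rw [if_pos hi0, if_pos hj0]; apply old hi0 hj0
      simp [hia, hia.trans hzij]
  · have hiz : ht f z i = yv := (hR i hi).resolve_left hi0 |>.1
    apply new
    · right; right; exact hi0
    · by_cases hj0 : act G f x j
      · right; left
        have hja : yv < ht f z j := by
          have := (oR j i hj0 hj hi hnij.symm).2.mp hij
          rwa [hiz] at this
        by_contra hne'
        have b1 := hemin j ⟨⟨hj0, hj⟩, hja⟩
        have b2 := ht_ne D (haz j hj0 hj) (hcz ep hep.1.1) hne'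
        have b3 := (oR j ep hj0 hj hep.1.2 hne').2.mpr (lt_of_le_of_ne b1 b2.symm)
        exact hcon ep hep.1.2 ((oR ep i hep.1.1 hep.1.2 hi (by rintro rfl; exact hi0 hep.1.1)).2.mpr (hiz ▸ hep.2)) b3
      · right; right; exact hj0


lemma sweep_false {V : Type} [Fintype V] {G : SimpleGraph V} {f : V → ℝ × ℝ} (D : Drw G f)
    (P : V → Set V) (J : V → V → Bool) (hP : ∀ u, u ∈ P u)
    (hJ : ∀ u, (∃ u', G.Adj u u') → ∀ v w, G.Adj v w → v ∉ P u → w ∉ P u →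
      (J u v ^^ J u w) = decide (above (f v) (f w) (f u)))
    (d : ℕ) (hd : ∀ v, (Finset.univ.filter (G.Adj v)).card ≤ d)
    (β : Finset V → Set V) (hanti : ∀ S T, S ⊆ T → β T ⊆ β S)
    (hne : ∀ T, T.card ≤ d + 5 → (β T).Nonempty) (hoff : ∀ T, ∀ y ∈ β T, y ∉ T)
    (hc : ∀ T, ∀ g : V → Bool, (∀ v w, G.Adj v w → (∀ u ∈ T, v ∉ P u) → (∀ u ∈ T, w ∉ P u) → g v = g w) →
      ∀ y ∈ β T, ∀ y' ∈ β T, g y = g y') : False := by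
  have main : ∀ n : ℕ, ∀ x : ℝ, (∀ u, (f u).1 ≠ x) →
      (Finset.univ.filter (fun u => (f u).1 < x)).card = n → ∃ φ, SwInv G f J β x φ := by
    intro n
    induction n using Nat.strong_induction_on with
    | _ n ih =>
      intro x' hx' hn
      by_cases he : (Finset.univ.filter (fun u => (f u).1 < x')).Nonempty
      · obtain ⟨v, hv, hmax⟩ := Finset.exists_max_image _ (fun u => (f u).1) he
        simp only [Finset.mem_filter, Finset.mem_univ, true_and] at hv hmax
        have hev : ∀ᶠ x in nhdsWithin (f v).1 (Set.Iio (f v).1), ∀ u, (f u).1 < (f v).1 → (f u).1 < x := by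
          rw [Filter.eventually_all]
          intro u
          by_cases h : (f u).1 < (f v).1
          · filter_upwards [mem_nhdsWithin_of_mem_nhds (Ioi_mem_nhds h)] with x hx _
            exact hx
          · simp [h]
        obtain ⟨x, hx1, hx2⟩ := (hev.and self_mem_nhdsWithin).exists
        have hgap : ∀ u, u ≠ v → (f u).1 < x ∨ x' < (f u).1 := by
          intro u hu
          by_cases h : (f u).1 < x'
          · left
            exact hx1 u (lt_of_le_of_ne (hmax u h) (fun h => hu (D.inj _ _ h)))
          · right
            exact lt_of_le_of_ne (not_lt.mp h) (hx' u).symm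
        have hxv : x < (f v).1 := hx2
        obtain ⟨φ, hφ⟩ := ih _ (by
          rw [← hn]
          apply Finset.card_lt_card
          rw [Finset.ssubset_iff_of_subset]
          · exact ⟨v, by simp [hv], by simp [hxv.le]⟩
          · intro u; simp only [Finset.mem_filter, Finset.mem_univ, true_and]
            intro h; exact h.trans (hxv.trans hv)) x (by
          intro u
          by_cases hu : u = v
          · subst hu; exact hxv.ne'
          · rcases hgap u hu with h | h
            · exact h.ne
            · exact ((hxv.trans hv).trans h).ne') rfl
        exact sweep_step D P J hP hJ d hd β hanti hne hoff hc hxv hv hgap φ hφ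
      · have hno : ∀ u, ¬ (f u).1 < x' := by
          intro u hu; exact he ⟨u, by simp [hu]⟩
        refine ⟨fun _ => false, rfl, rfl, ?_⟩
        intro i j hi hj hij _ y _
        rcases i with _ | _ | ⟨a, b⟩
        · rcases j with _ | _ | ⟨a, b⟩
          · simp [FF]
          · simp [FF, not_lt.mp (hno y)]
          · exact absurd hj.2.1 (hno a)
        · simp [ht] at hij
        · exact absurd hi.2.1 (hno a)
  have hev : ∀ᶠ x in Filter.atTop, ∀ u : V, (f u).1 < x := by
    rw [Filter.eventually_all]; intro u; exact Filter.eventually_gt_atTop _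
  obtain ⟨x, hx⟩ := hev.exists
  obtain ⟨φ, h0, h1, hφ⟩ := main _ x (fun u => (hx u).ne) rfl
  obtain ⟨y, hy⟩ := hne ∅ (by simp)
  have := hφ none (some none) trivial trivial (by simp [ht]) (by
    intro k hk hk1 hk2
    rcases k with _ | _ | ⟨a, b⟩
    · exact absurd hk1 (lt_irrefl _)
    · simp at hk2
    · exact absurd hk.2.2 (hx b).not_gt) y (by simpa [TT] using hy)
  simp [FF, h0, h1, hx y] at this


lemma dist_pred {V : Type} {G : SimpleGraph V} {r u : V} {n : ℕ} (hr : G.Reachable r u)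
    (hd : G.dist r u = n + 1) : ∃ u', G.Adj u' u ∧ G.Reachable r u' ∧ G.dist r u' = n := by
  obtain ⟨p, hp⟩ := hr.symm.exists_walk_length_eq_dist
  rw [SimpleGraph.dist_comm, hd] at hp
  cases p with
  | nil => simp at hp
  | cons h q =>
    rename_i u'
    have h1 : G.dist r u' ≤ n := by
      have := SimpleGraph.dist_le q.reverse
      simp at this hp; omega
    have h2 : G.Reachable r u' := ⟨q.reverse⟩
    refine ⟨u', h.symm, h2, le_antisymm h1 ?_⟩
    obtain ⟨q', hq'⟩ := h2.exists_walk_length_eq_dist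
    have := SimpleGraph.dist_le (q'.concat h.symm)
    simp at this; omega

lemma dist_adj {V : Type} {G : SimpleGraph V} {r u v : V} (hr : G.Reachable r u)
    (h : G.Adj u v) : G.dist r v ≤ G.dist r u + 1 := by
  obtain ⟨q', hq'⟩ := hr.exists_walk_length_eq_dist
  have := SimpleGraph.dist_le (q'.concat h)
  simp at this; omega

lemma exJ {V : Type} {G : SimpleGraph V} {f : V → ℝ × ℝ} (D : Drw G f) (r : V)
    (hmin : ∀ u, G.Reachable r u → (f r).1 ≤ (f u).1) : ∀ n u, G.Reachable r u → G.dist r u = n →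
    ∃ (P : Finset V) (J : V → Bool), u ∈ P ∧ (∀ p ∈ P, G.Reachable r p ∧ G.dist r p ≤ n) ∧
      (∀ p ∈ P, ∀ q ∈ P, G.dist r p = G.dist r q → p = q) ∧
      ∀ v w, G.Adj v w → G.Reachable r v → v ∉ P → w ∉ P →
        (J v ^^ J w) = decide (above (f v) (f w) (f u)) := by
  intro n
  induction n with
  | zero =>
    intro u hu h0
    have : r = u := (hu.dist_eq_zero_iff).mp h0
    subst this
    refine ⟨{r}, fun _ => false, by simp, by simp, by simp, ?_⟩
    intro v w hvw hv _ _
    have h1 := hmin v hv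
    have h2 := hmin w (hv.trans hvw.reachable)
    symm
    simp only [Bool.xor_self, decide_eq_false_iff_not]
    rintro ⟨h | h, _⟩ <;> linarith [h.1, h.2]
  | succ n ih =>
    intro u hu hn
    obtain ⟨u', hadj, hr', hd'⟩ := dist_pred hu hn
    obtain ⟨P, J, h1, h2, h3, h4⟩ := ih u' hr' hd'
    refine ⟨insert u P, fun y => J y ^^ decide (below (f u') (f u) (f y)), by simp, ?_, ?_, ?_⟩
    · intro p hp
      rcases Finset.mem_insert.mp hp with rfl | hp
      · exact ⟨hu, hn.le⟩
      · exact ⟨(h2 p hp).1, (h2 p hp).2.trans (Nat.le_succ _)⟩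
    · intro p hp q hq he
      rcases Finset.mem_insert.mp hp with rfl | hp0 <;> rcases Finset.mem_insert.mp hq with rfl | hq0
      · rfl
      · have := (h2 q hq0).2; omega
      · have := (h2 p hp0).2; omega
      · exact h3 p hp0 q hq0 he
    · intro v w hvw hv hvP hwP
      simp only [Finset.mem_insert, not_or] at hvP hwP
      have e1 := h4 v w hvw hv hvP.2 hwP.2
      have a1 : u' ≠ v := by rintro rfl; exact hvP.2 h1
      have a2 : u' ≠ w := by rintro rfl; exact hwP.2 h1
      have e2 := four (f u') (f u) (f v) (f w) (fun h => hadj.ne (D.inj _ _ h))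
        (fun h => hvw.ne (D.inj _ _ h)) (fun h => a1 (D.inj _ _ h)) (fun h => a2 (D.inj _ _ h))
        (fun h => hvP.1 (D.inj _ _ h).symm) (fun h => hwP.1 (D.inj _ _ h).symm)
        (fun z z1 z2 => D.ln_ne_dis hadj hvw a1 a2 (Ne.symm hvP.1) (Ne.symm hwP.1) z z1 z2)
      beta_reduce
      revert e1 e2
      generalize decide (above (f v) (f w) (f u')) = q1
      generalize decide (above (f v) (f w) (f u)) = q2
      generalize decide (below _ _ (f v)) = q3
      generalize decide (below _ _ (f w)) = q4
      generalize J v = q5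
      generalize J w = q6
      revert q1 q2 q3 q4 q5 q6
      decide

lemma exDrw {V : Type} [Fintype V] {G : SimpleGraph V} (f : V → ℝ × ℝ) (hf : Function.Injective f)
    (h1 : ∀ a b c d : V, G.Adj a b → G.Adj c d → ({a, b} : Set V) ∩ {c, d} = ∅ →
      segment ℝ (f a) (f b) ∩ segment ℝ (f c) (f d) = ∅)
    (h2 : ∀ a b c : V, G.Adj a b → G.Adj a c → b ≠ c →
      segment ℝ (f a) (f b) ∩ segment ℝ (f a) (f c) = {f a})
    (h3 : ∀ a b v : V, G.Adj a b → v ≠ a → v ≠ b → f v ∉ segment ℝ (f a) (f b)) :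
    ∃ g : V → ℝ × ℝ, Drw G g := by
  obtain ⟨ε, hε⟩ : ∃ ε : ℝ, ∀ u v, (f u).1 + ε * (f u).2 = (f v).1 + ε * (f v).2 → u = v := by
    have hfin : (⋃ p : V × V, {ε : ℝ | p.1 ≠ p.2 ∧ (f p.1).1 + ε * (f p.1).2 = (f p.2).1 + ε * (f p.2).2}).Finite := by
      apply Set.finite_iUnion
      rintro ⟨u, v⟩
      apply Set.Subsingleton.finite
      rintro e ⟨he, he'⟩ e' ⟨_, he''⟩
      simp only at he he' he''
      by_cases h : (f u).2 = (f v).2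
      · exfalso; apply he; apply hf; apply Prod.ext _ h
        rw [h] at he'; linarith
      · have : (e - e') * ((f u).2 - (f v).2) = 0 := by linarith
        rcases mul_eq_zero.mp this with h' | h'
        · linarith
        · exact absurd (by linarith) h
    obtain ⟨ε, hε⟩ := hfin.infinite_compl.nonempty
    refine ⟨ε, fun u v h => ?_⟩
    by_contra hne
    apply hε
    rw [Set.mem_iUnion]
    exact ⟨(u, v), hne, h⟩
  let L : ℝ × ℝ →ₗ[ℝ] ℝ × ℝ :=
    { toFun := fun p => (p.1 + ε * p.2, p.2)
      map_add' := by intro x y; ext <;> simp; ring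
      map_smul' := by intro m x; ext <;> simp; ring }
  have hL : Function.Injective L := by
    intro p q h
    simp only [L, LinearMap.coe_mk, AddHom.coe_mk, Prod.mk.injEq] at h
    apply Prod.ext _ h.2
    have := h.1; rw [h.2] at this; linarith
  have hs : ∀ a b, segment ℝ (L (f a)) (L (f b)) = L '' segment ℝ (f a) (f b) := by
    intro a b
    exact (image_segment ℝ L.toAffineMap (f a) (f b)).symm
  refine ⟨fun v => L (f v), ⟨?_, ?_, ?_, ?_⟩⟩
  · intro u v h
    exact hε u v h
  · intro a b c d hab hcd n1 n2 n3 n4 p hp hq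
    rw [hs] at hp hq
    obtain ⟨p', hp', rfl⟩ := hp
    obtain ⟨q', hq', h⟩ := hq
    rw [hL h] at hq'
    have := h1 a b c d hab hcd (by
      ext x; simp only [Set.mem_inter_iff, Set.mem_insert_iff, Set.mem_singleton_iff, Set.mem_empty_iff_false, iff_false]
      rintro ⟨h | h, h' | h'⟩
      · exact n1 (h.symm.trans h')
      · exact n2 (h.symm.trans h')
      · exact n3 (h.symm.trans h')
      · exact n4 (h.symm.trans h'))
    have h' : p' ∈ segment ℝ (f a) (f b) ∩ segment ℝ (f c) (f d) := ⟨hp', hq'⟩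
    rw [this] at h'; exact h'
  · intro a b c hab hac hne p hp hq
    rw [hs] at hp hq
    obtain ⟨p', hp', rfl⟩ := hp
    obtain ⟨q', hq', h⟩ := hq
    rw [hL h] at hq'
    have h' : p' ∈ segment ℝ (f a) (f b) ∩ segment ℝ (f a) (f c) := ⟨hp', hq'⟩
    rw [h2 a b c hab hac hne] at h'
    rw [h']
  · intro a b v hab n1 n2 hp
    rw [hs] at hp
    obtain ⟨p', hp', h⟩ := hp
    rw [hL h] at hp'
    exact h3 a b v hab n1 n2 hp'

lemma Drw.mono {V : Type} {G G' : SimpleGraph V} {f : V → ℝ × ℝ} (D : Drw G f) (h : G' ≤ G) : Drw G' f :=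
  ⟨D.inj, fun a b c d x y => D.dis a b c d (h x) (h y), fun a b c x y => D.sh a b c (h x) (h y),
    fun a b v x => D.off a b v (h x)⟩


def Conn {V : Type} (H : SimpleGraph V) (K : Finset V) : Prop :=
  ∀ A : Set V, (∀ u ∈ K, ∀ v ∈ K, H.Adj u v → u ∈ A → v ∈ A) → ∀ u ∈ K, ∀ v ∈ K, u ∈ A → v ∈ A

lemma div_step {T n m : ℕ} (hT : 0 < T) (h1 : n ≤ m + 1) (h2 : m ≤ n + 1) (hn : n % T ≠ 0) (hm : m % T ≠ 0) :
    n / T = m / T := by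
  have key : ∀ a b : ℕ, a ≤ b + 1 → a % T ≠ 0 → a / T ≤ b / T := by
    intro a b hab ha
    have e := Nat.div_add_mod a T
    rw [Nat.le_div_iff_mul_le hT]
    have : T * (a / T) = a / T * T := mul_comm _ _
    omega
  exact le_antisymm (key n m h1 hn) (key m n h2 hm)

lemma heavy_meet {V : Type} {S K K' : Finset V} (h : S.card < 2 * (S ∩ K).card)
    (h' : S.card < 2 * (S ∩ K').card) : ∃ y, y ∈ K ∧ y ∈ K' := by
  by_contra hne
  push Not at hne
  have hdis : Disjoint (S ∩ K) (S ∩ K') := by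
    rw [Finset.disjoint_left]
    intro a ha hb
    exact hne a (Finset.mem_inter.mp ha).2 (Finset.mem_inter.mp hb).2
  have e := Finset.card_union_of_disjoint hdis
  have : ((S ∩ K) ∪ (S ∩ K')).card ≤ S.card :=
    Finset.card_le_card (Finset.union_subset Finset.inter_subset_left Finset.inter_subset_left)
  omega

lemma sep {V : Type} [Fintype V] {G : SimpleGraph V} {f : V → ℝ × ℝ} (D : Drw G f)
    (d : ℕ) (hd : ∀ v, (Finset.univ.filter (G.Adj v)).card ≤ d)
    (rt : V → V) (hrt1 : ∀ v, G.Reachable (rt v) v) (hrt2 : ∀ u v, G.Reachable u v → rt u = rt v)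
    (hrt3 : ∀ v u, G.Reachable (rt v) u → (f (rt v)).1 ≤ (f u).1)
    (lay : V → ℕ) (hlay : ∀ v, lay v = G.dist (rt v) v)
    (T i : ℕ) (hT : 2 ≤ T) (H : SimpleGraph V)
    (hH : ∀ u v, H.Adj u v ↔ G.Adj u v ∧ (lay u + i) % T ≠ 0 ∧ (lay v + i) % T ≠ 0) :
    ∀ S : Finset V, ∃ Z : Finset V, Z.card ≤ (d + 5) * (T - 1) ∧
      ∀ K, Conn H K → Disjoint K Z → 2 * (S ∩ K).card ≤ S.card := by
  intro S
  by_contra hbad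
  push Not at hbad
  have hlip : ∀ u v, G.Adj u v → lay v ≤ lay u + 1 := by
    intro u v h
    rw [hlay, hlay, ← hrt2 u v h.reachable]
    exact dist_adj (hrt1 u) h
  -- slab lemma
  have slab : ∀ K, Conn H K → ∀ y ∈ K, (lay y + i) % T ≠ 0 → ∀ w ∈ K,
      rt w = rt y ∧ (lay w + i) % T ≠ 0 ∧ (lay w + i) / T = (lay y + i) / T := by
    intro K hK y hy hr w hw
    refine hK {w | rt w = rt y ∧ (lay w + i) % T ≠ 0 ∧ (lay w + i) / T = (lay y + i) / T} ?_ y hy w hw ⟨rfl, hr, rfl⟩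
    rintro u _ v _ huv ⟨a1, a2, a3⟩
    rw [hH] at huv
    refine ⟨?_, huv.2.2, ?_⟩
    · rw [← hrt2 u v huv.1.reachable, a1]
    · rw [← a3]
      have := hlip u v huv.1
      have := hlip v u huv.1.symm
      exact div_step (by omega) (by omega) (by omega) huv.2.2 huv.2.1
  obtain ⟨K0, hK0, _, hh0⟩ := hbad ∅ (by simp)
  obtain ⟨y0, hy0⟩ : K0.Nonempty := by
    rw [Finset.nonempty_iff_ne_empty]; rintro rfl; simp at hh0
  have hk : 1 ≤ (d + 5) * (T - 1) := Nat.mul_pos (by omega) (by omega)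
  have hres : (lay y0 + i) % T ≠ 0 := by
    intro h0
    have hsub : ∀ u ∈ K0, u = y0 := by
      intro u hu
      refine hK0 {w | w = y0} ?_ y0 hy0 u hu rfl
      intro a _ b _ hab ha
      rw [Set.mem_setOf_eq] at ha
      subst ha
      rw [hH] at hab
      exact absurd h0 hab.2.1
    obtain ⟨K, hK, hdis, hh⟩ := hbad {y0} (by simpa using hk)
    obtain ⟨y, h1, h2⟩ := heavy_meet hh0 hh
    have := hsub y h1
    subst this
    simp at hdis
    exact hdis h2
  set DD : Finset V := Finset.univ.filter (fun w => rt w = rt y0 ∧ (lay w + i) % T ≠ 0 ∧ (lay w + i) / T = (lay y0 + i) / T) with hDD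
  have hKD : ∀ K, Conn H K → S.card < 2 * (S ∩ K).card → K ⊆ DD := by
    intro K hK hh w hw
    obtain ⟨y, h1, h2⟩ := heavy_meet hh0 hh
    have a := slab K0 hK0 y0 hy0 hres y h1
    have b := slab K hK y h2 a.2.1 w hw
    simp only [hDD, Finset.mem_filter, Finset.mem_univ, true_and]
    exact ⟨b.1.trans a.1, b.2.1, b.2.2.trans a.2.2⟩
  set r := rt y0 with hr
  have hex : ∀ u, ∃ (P : Finset V) (J : V → Bool), u ∈ P ∧ (P ∩ DD).card ≤ T - 1 ∧
      (G.Reachable r u → ∀ v w, G.Adj v w → G.Reachable r v → v ∉ P → w ∉ P →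
        (J v ^^ J w) = decide (above (f v) (f w) (f u))) := by
    intro u
    by_cases hu : G.Reachable r u
    · obtain ⟨P, J, h1, h2, h3, h4⟩ := exJ D r (hrt3 y0) _ u hu rfl
      refine ⟨P, J, h1, ?_, fun _ => h4⟩
      have : T - 1 = ((Finset.range T).erase 0).card := by
        rw [Finset.card_erase_of_mem (by simp; omega), Finset.card_range]
      rw [this]
      apply Finset.card_le_card_of_injOn (fun w => (lay w + i) % T)
      · intro w hw
        simp only [hDD, Finset.coe_inter, Set.mem_inter_iff, Finset.mem_coe, Finset.mem_filter, Finset.mem_univ, true_and] at hw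
        simp only [Finset.coe_erase, Finset.coe_range, Set.mem_diff, Set.mem_Iio, Set.mem_singleton_iff]
        exact ⟨Nat.mod_lt _ (by omega), hw.2.2.1⟩
      · intro w hw w' hw' he
        simp only [hDD, Finset.coe_inter, Set.mem_inter_iff, Finset.mem_coe, Finset.mem_filter, Finset.mem_univ, true_and] at hw hw' he
        apply h3 w hw.1 w' hw'.1
        have e1 := Nat.div_add_mod (lay w + i) T
        have e2 := Nat.div_add_mod (lay w' + i) T
        rw [hw.2.2.2, he] at e1
        rw [hw'.2.2.2] at e2
        have e3 := hlay w
        have e4 := hlay w'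
        rw [hw.2.1] at e3
        rw [hw'.2.1] at e4
        omega
    · refine ⟨{u}, fun _ => false, by simp, ?_, fun h => absurd h hu⟩
      calc _ ≤ ({u} : Finset V).card := Finset.card_le_card Finset.inter_subset_left
        _ ≤ _ := by simp; omega
  choose P J hP hPD hJ using hex
  let G0 : SimpleGraph V :=
    { Adj := fun u v => G.Adj u v ∧ G.Reachable r u
      symm := ⟨fun u v h => ⟨h.1.symm, h.2.trans h.1.reachable⟩⟩
      loopless := ⟨fun u h => h.1.ne rfl⟩ }
  have hG0 : ∀ u v, G0.Adj u v ↔ G.Adj u v ∧ G.Reachable r u := fun u v => Iff.rfl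
  have D0 : Drw G0 f := D.mono (fun u v h => h.1)
  refine sweep_false D0 (fun u => (P u : Set V)) J (fun u => by simpa using hP u) ?_ d ?_
    (fun T' => {y | ∃ K, Conn H K ∧ S.card < 2 * (S ∩ K).card ∧ y ∈ K ∧ ∀ u ∈ T', Disjoint K (P u)}) ?_ ?_ ?_ ?_
  · rintro u ⟨u', hu'⟩ v w hvw hv hw
    exact hJ u hu'.2 v w hvw.1 hvw.2 (by simpa using hv) (by simpa using hw)
  · intro v
    refine le_trans (Finset.card_le_card ?_) (hd v)
    intro u; simp only [Finset.mem_filter, Finset.mem_univ, true_and]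
    exact fun h => h.1
  · rintro A B hAB y ⟨K, h1, h2, h3, h4⟩
    exact ⟨K, h1, h2, h3, fun u hu => h4 u (hAB hu)⟩
  · intro A hA
    obtain ⟨K, hK, hdis, hh⟩ := hbad (A.biUnion (fun u => P u ∩ DD)) (by
      refine le_trans (Finset.card_biUnion_le_card_mul A _ (T - 1) (fun u _ => hPD u)) ?_
      exact Nat.mul_le_mul_right _ hA)
    obtain ⟨y, h1, h2⟩ := heavy_meet hh0 hh
    refine ⟨y, K, hK, hh, h2, ?_⟩
    intro u hu
    rw [Finset.disjoint_left] at hdis ⊢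
    intro a ha ha'
    apply hdis ha
    simp only [Finset.mem_biUnion]
    exact ⟨u, hu, Finset.mem_inter.mpr ⟨ha', hKD K hK hh ha⟩⟩
  · rintro A y ⟨K, h1, h2, h3, h4⟩ hy
    exact Finset.disjoint_left.mp (h4 y hy) h3 (hP y)
  · intro A g hg
    have key : ∀ K, Conn H K → S.card < 2 * (S ∩ K).card → (∀ u ∈ A, Disjoint K (P u)) →
        ∀ y ∈ K, ∀ y' ∈ K, g y' = g y := by
      intro K hK hh hdis y hy y' hy'
      refine hK {w | g w = g y} ?_ y hy y' hy' rfl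
      intro a ha b hb hab hga
      rw [Set.mem_setOf_eq] at hga ⊢
      rw [← hga]
      symm
      apply hg
      · refine ⟨((hH a b).mp hab).1, ?_⟩
        have := hKD K hK hh ha
        simp only [hDD, Finset.mem_filter, Finset.mem_univ, true_and] at this
        rw [← this.1]
        exact hrt1 a
      · intro u hu; simpa using Finset.disjoint_left.mp (hdis u hu) ha
      · intro u hu; simpa using Finset.disjoint_left.mp (hdis u hu) hb
    rintro y ⟨K, h1, h2, h3, h4⟩ y' ⟨K', h1', h2', h3', h4'⟩
    obtain ⟨z, hz, hz'⟩ := heavy_meet h2 h2'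
    rw [← key K h1 h2 h4 y h3 z hz, ← key K' h1' h2' h4' y' h3' z hz']


noncomputable def cmpt {V : Type} [Fintype V] (H : SimpleGraph V) (C : Finset V) (v : V) : Finset V :=
  C.filter (fun w => ∀ A : Set V, (∀ u ∈ C, ∀ v ∈ C, H.Adj u v → u ∈ A → v ∈ A) → v ∈ A → w ∈ A)

section
variable {V : Type} [Fintype V] {H : SimpleGraph V} {C : Finset V}

lemma mem_cmpt {v w : V} : w ∈ cmpt H C v ↔ w ∈ C ∧ ∀ A : Set V, (∀ u ∈ C, ∀ v ∈ C, H.Adj u v → u ∈ A → v ∈ A) → v ∈ A → w ∈ A := by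
  simp [cmpt]

lemma cmpt_sub (v : V) : cmpt H C v ⊆ C := Finset.filter_subset _ _

lemma self_mem_cmpt {v : V} (hv : v ∈ C) : v ∈ cmpt H C v := by
  rw [mem_cmpt]; exact ⟨hv, fun A _ h => h⟩

lemma cmpt_adj {v u w : V} (hu : u ∈ cmpt H C v) (hw : w ∈ C) (h : H.Adj u w) : w ∈ cmpt H C v := by
  rw [mem_cmpt] at hu ⊢
  exact ⟨hw, fun A hA hv => hA u hu.1 w hw h (hu.2 A hA hv)⟩

lemma cmpt_conn {v : V} (hv : v ∈ C) : Conn H (cmpt H C v) := by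
  have fwd : ∀ A : Set V, (∀ u ∈ cmpt H C v, ∀ w ∈ cmpt H C v, H.Adj u w → u ∈ A → w ∈ A) → v ∈ A →
      ∀ w ∈ cmpt H C v, w ∈ A := by
    intro A hA hvA w hw
    have := (mem_cmpt.mp hw).2 {x | x ∈ A ∧ x ∈ cmpt H C v} (by
      rintro a _ b hb hab ⟨h1, h2⟩
      have := cmpt_adj h2 hb hab
      exact ⟨hA a h2 b this hab h1, this⟩) ⟨hvA, self_mem_cmpt hv⟩
    exact this.1
  intro A hA u hu w hw huA
  apply fwd A hA _ w hw
  by_contra hvA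
  exact fwd Aᶜ (fun a ha b hb hab h1 h2 => h1 (hA b hb a ha hab.symm h2)) hvA u hu huA

lemma conn_sub {K : Finset V} (hK : Conn H K) (hKC : K ⊆ C) {v : V} (hv : v ∈ K) : K ⊆ cmpt H C v := by
  intro w hw
  rw [mem_cmpt]
  exact ⟨hKC hw, fun A hA hvA => hK A (fun a ha b hb => hA a (hKC ha) b (hKC hb)) v hv w hw hvA⟩

lemma cmpt_eq {v w : V} (hv : v ∈ C) (hw : w ∈ cmpt H C v) : cmpt H C w = cmpt H C v := by
  have hwC := cmpt_sub _ hw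
  have h1 : cmpt H C v ⊆ cmpt H C w := conn_sub (cmpt_conn hv) (cmpt_sub v) hw
  have h2 : cmpt H C w ⊆ cmpt H C v := conn_sub (cmpt_conn hwC) (cmpt_sub w) (h1 (self_mem_cmpt hv))
  exact Finset.Subset.antisymm h2 h1

lemma halving {k : ℕ} (hsep : ∀ S : Finset V, ∃ Z : Finset V, Z.card ≤ k ∧
      ∀ K, Conn H K → Disjoint K Z → 2 * (S ∩ K).card ≤ S.card) : ∀ j : ℕ, ∀ S : Finset V,
    ∃ Z : Finset V, Z.card ≤ k * 2 ^ (j + 1) ∧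
      ∀ K, Conn H K → Disjoint K Z → 2 ^ j * (S ∩ K).card ≤ S.card := by
  intro j
  induction j with
  | zero =>
    intro S
    exact ⟨∅, by simp, fun K _ _ => by simpa using Finset.card_le_card Finset.inter_subset_left⟩
  | succ j ih =>
    intro S
    obtain ⟨Z0, hZ0, hZ⟩ := ih S
    choose Zf hZf1 hZf2 using hsep
    set C : Finset V := Finset.univ \ Z0 with hC
    set F : Finset (Finset V) := (C.image (cmpt H C)).filter (fun K => S.card < 2 ^ (j + 1) * (S ∩ K).card) with hF
    have hFc : F.card ≤ 2 ^ (j + 1) := by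
      have hdis : (F : Set (Finset V)).PairwiseDisjoint (fun K => S ∩ K) := by
        intro K hK K' hK' hne
        simp only [hF, Finset.coe_filter, Finset.mem_image, Set.mem_setOf_eq] at hK hK'
        obtain ⟨⟨v, hv, rfl⟩, _⟩ := hK
        obtain ⟨⟨v', hv', rfl⟩, _⟩ := hK'
        show Disjoint _ _
        rw [Finset.disjoint_left]
        intro a ha ha'
        apply hne
        rw [← cmpt_eq hv (Finset.mem_inter.mp ha).2, ← cmpt_eq hv' (Finset.mem_inter.mp ha').2]
      have h1 := Finset.card_biUnion hdis
      have h2 : (F.biUnion (fun K => S ∩ K)).card ≤ S.card := by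
        apply Finset.card_le_card
        intro a ha
        simp only [Finset.mem_biUnion, Finset.mem_inter] at ha
        obtain ⟨_, _, h, _⟩ := ha
        exact h
      have h3 : F.card * (S.card + 1) ≤ 2 ^ (j + 1) * ∑ K ∈ F, (S ∩ K).card := by
        rw [Finset.mul_sum, ← smul_eq_mul, ]
        apply Finset.card_nsmul_le_sum
        intro K hK
        have := (Finset.mem_filter.mp hK).2
        omega
      have h4 : F.card * (S.card + 1) ≤ 2 ^ (j + 1) * S.card := by
        refine h3.trans (Nat.mul_le_mul_left _ ?_)
        rw [← h1]; exact h2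
      by_contra hcon
      push Not at hcon
      have h5 := Nat.mul_le_mul_right (S.card) hcon.le
      have h6 : 0 < F.card := lt_of_le_of_lt (Nat.zero_le _) hcon
      rw [mul_add, mul_one] at h4
      omega
    refine ⟨Z0 ∪ F.biUnion (fun K => Zf (S ∩ K)), ?_, ?_⟩
    · refine (Finset.card_union_le _ _).trans ?_
      have := Finset.card_biUnion_le_card_mul F (fun K => Zf (S ∩ K)) k (fun K _ => hZf1 _)
      have : F.card * k ≤ 2 ^ (j + 1) * k := Nat.mul_le_mul_right _ hFc
      rw [pow_succ 2 (j + 1)]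
      nlinarith
    · intro K hK hdis
      rw [Finset.disjoint_union_right] at hdis
      rcases K.eq_empty_or_nonempty with rfl | ⟨v, hv⟩
      · simp
      have hKC : K ⊆ C := by
        intro w hw; simp only [hC, Finset.mem_sdiff, Finset.mem_univ, true_and]
        exact Finset.disjoint_left.mp hdis.1 hw
      have hsub := conn_sub hK hKC hv
      have hm : (S ∩ K).card ≤ (S ∩ cmpt H C v).card := Finset.card_le_card (Finset.inter_subset_inter_left hsub)
      by_cases hh : S.card < 2 ^ (j + 1) * (S ∩ cmpt H C v).card
      · have hmem : cmpt H C v ∈ F := by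
          simp only [hF, Finset.mem_filter, Finset.mem_image]
          exact ⟨⟨v, hKC hv, rfl⟩, hh⟩
        have e1 := hZf2 (S ∩ cmpt H C v) K hK (by
          rw [Finset.disjoint_biUnion_right] at hdis
          exact hdis.2 _ hmem)
        have e2 := hZ (cmpt H C v) (cmpt_conn (hKC hv)) (by
          rw [Finset.disjoint_left]; intro a ha
          have := cmpt_sub _ ha
          simp only [hC, Finset.mem_sdiff, Finset.mem_univ, true_and] at this
          exact this)
        rw [Finset.inter_assoc, Finset.inter_eq_right.mpr hsub] at e1
        calc 2 ^ (j + 1) * (S ∩ K).card = 2 ^ j * (2 * (S ∩ K).card) := by ring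
          _ ≤ 2 ^ j * (S ∩ cmpt H C v).card := Nat.mul_le_mul_left _ e1
          _ ≤ _ := e2
      · exact (Nat.mul_le_mul_left _ hm).trans (not_lt.mp hh)

def cc (b d : ℕ) : ℕ → ℕ
  | 0 => 0
  | l + 1 => b + b * d * cc b d l

lemma level {d q : ℕ} (hdH : ∀ v, (Finset.univ.filter (H.Adj v)).card ≤ d)
    (hq : ∀ S : Finset V, ∃ Z : Finset V, Z.card ≤ q ∧
      ∀ K, Conn H K → Disjoint K Z → 2 * d * (S ∩ K).card ≤ S.card) (hd : 1 ≤ d) :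
    ∀ n : ℕ, ∀ C : Finset V, C.card ≤ n → Conn H C → ∀ S ⊆ C, S.Nonempty → S.card ≤ 2 * d * q →
    ∃ lam : V → ℕ, (∀ u ∈ C, ∀ v ∈ C, H.Adj u v → lam v ≤ lam u + 1) ∧ (∀ s ∈ S, lam s = 0) ∧
      (∀ l, (C.filter (fun v => lam v < l)).card ≤ cc (2 * d * q + q) d l) ∧
      (∀ a l, ∀ K ⊆ C, Conn H K → (∀ v ∈ K, a ≤ lam v ∧ lam v < a + l) → K.card ≤ cc (2 * d * q + q) d l) := by
  intro n
  induction n with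
  | zero =>
    intro C hC _ S hS hSne
    have : C = ∅ := by simpa using hC
    subst this
    exact absurd (Finset.subset_empty.mp hS) hSne.ne_empty
  | succ n ih =>
    intro C hC hCc S hS hSne hSM
    set N : Finset V → Finset V := fun B => B.biUnion (fun v => Finset.univ.filter (H.Adj v)) with hN
    have hNc : ∀ B : Finset V, (N B).card ≤ B.card * d := fun B =>
      Finset.card_biUnion_le_card_mul B _ d (fun v _ => hdH v)
    have hNm : ∀ B v, v ∈ N B ↔ ∃ u ∈ B, H.Adj u v := by
      intro B v; simp [hN]
    obtain ⟨Z, hZ, hZK⟩ := hq (N S)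
    set B : Finset V := S ∪ (Z ∩ C) with hB
    have hBc : B.card ≤ 2 * d * q + q := by
      refine (Finset.card_union_le _ _).trans (add_le_add hSM ?_)
      exact (Finset.card_le_card Finset.inter_subset_left).trans hZ
    set E : Finset V := C \ B with hE
    have hEC : E ⊆ C := Finset.sdiff_subset
    have hEn : E.card ≤ n := by
      have : E ⊂ C := by
        rw [Finset.ssubset_iff_of_subset hEC]
        obtain ⟨s, hs⟩ := hSne
        exact ⟨s, hS hs, by simp [hE, hB, hs]⟩
      have := Finset.card_lt_card this
      omega
    have hnotB : ∀ {v}, v ∈ E → v ∉ B := fun h => (Finset.mem_sdiff.mp h).2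
    -- nonempty attachments
    have hatt : ∀ v ∈ E, (N B ∩ cmpt H E v).Nonempty := by
      intro v hv
      by_contra hne
      rw [Finset.not_nonempty_iff_eq_empty] at hne
      obtain ⟨s, hs⟩ := hSne
      have := hCc {w | w ∈ cmpt H E v} (by
        intro a ha b hb hab haA
        rw [Set.mem_setOf_eq] at haA ⊢
        by_cases hbB : b ∈ B
        · have : a ∈ N B ∩ cmpt H E v := Finset.mem_inter.mpr ⟨(hNm _ _).mpr ⟨b, hbB, hab.symm⟩, haA⟩
          rw [hne] at this; simp at this
        · exact cmpt_adj haA (Finset.mem_sdiff.mpr ⟨hb, hbB⟩) hab) v (hEC hv) s (hS hs) (self_mem_cmpt hv)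
      exact hnotB (cmpt_sub _ this) (Finset.mem_union_left _ hs)
    have hcardS' : ∀ v ∈ E, (N B ∩ cmpt H E v).card ≤ 2 * d * q := by
      intro v hv
      have h1 : N B ∩ cmpt H E v ⊆ (N S ∩ cmpt H E v) ∪ N Z := by
        intro w hw
        rw [Finset.mem_inter, hNm] at hw
        obtain ⟨⟨u, hu, huw⟩, hw⟩ := hw
        rcases Finset.mem_union.mp hu with hu | hu
        · exact Finset.mem_union_left _ (Finset.mem_inter.mpr ⟨(hNm _ _).mpr ⟨u, hu, huw⟩, hw⟩)
        · exact Finset.mem_union_right _ ((hNm _ _).mpr ⟨u, (Finset.mem_inter.mp hu).1, huw⟩)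
      have h2 := (Finset.card_le_card h1).trans (Finset.card_union_le _ _)
      have h3 := hZK (cmpt H E v) (cmpt_conn hv) (by
        rw [Finset.disjoint_left]
        intro a ha haZ
        have haE := cmpt_sub _ ha
        exact hnotB haE (Finset.mem_union_right _ (Finset.mem_inter.mpr ⟨haZ, hEC haE⟩)))
      have h4 := hNc S
      have h5 := hNc Z
      have h6 : Z.card * d ≤ q * d := Nat.mul_le_mul_right _ hZ
      have h7 : S.card * d ≤ 2 * d * q * d := Nat.mul_le_mul_right _ hSM
      have h8 : (N S ∩ cmpt H E v).card ≤ d * q := by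
        by_contra hcon
        push Not at hcon
        have : 2 * d * (d * q + 1) ≤ 2 * d * (N S ∩ cmpt H E v).card := Nat.mul_le_mul_left _ hcon
        nlinarith
      nlinarith
    have hall : ∀ v : V, ∃ lam : V → ℕ, v ∈ E → (∀ u ∈ cmpt H E v, ∀ w ∈ cmpt H E v, H.Adj u w → lam w ≤ lam u + 1) ∧
      (∀ s ∈ N B ∩ cmpt H E v, lam s = 0) ∧
      (∀ l, ((cmpt H E v).filter (fun v => lam v < l)).card ≤ cc (2 * d * q + q) d l) ∧
      (∀ a l, ∀ K ⊆ cmpt H E v, Conn H K → (∀ v ∈ K, a ≤ lam v ∧ lam v < a + l) → K.card ≤ cc (2 * d * q + q) d l) := by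
      intro v
      by_cases hv : v ∈ E
      · obtain ⟨lam, h⟩ := ih (cmpt H E v) ((Finset.card_le_card (cmpt_sub _)).trans hEn) (cmpt_conn hv)
          (N B ∩ cmpt H E v) Finset.inter_subset_right (hatt v hv) (hcardS' v hv)
        exact ⟨lam, fun _ => h⟩
      · exact ⟨fun _ => 0, fun h => absurd h hv⟩
    choose L0 hL0 using hall
    -- make it depend on the component only
    obtain ⟨L, hL⟩ : ∃ L : Finset V → V → ℕ, ∀ v ∈ E, (∀ u ∈ cmpt H E v, ∀ w ∈ cmpt H E v, H.Adj u w → L (cmpt H E v) w ≤ L (cmpt H E v) u + 1) ∧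
      (∀ s ∈ N B ∩ cmpt H E v, L (cmpt H E v) s = 0) ∧
      (∀ l, ((cmpt H E v).filter (fun w => L (cmpt H E v) w < l)).card ≤ cc (2 * d * q + q) d l) ∧
      (∀ a l, ∀ K ⊆ cmpt H E v, Conn H K → (∀ w ∈ K, a ≤ L (cmpt H E v) w ∧ L (cmpt H E v) w < a + l) → K.card ≤ cc (2 * d * q + q) d l) := by
      refine ⟨fun K => if h : ∃ v ∈ E, cmpt H E v = K then L0 h.choose else fun _ => 0, ?_⟩
      intro v hv
      have h : ∃ v' ∈ E, cmpt H E v' = cmpt H E v := ⟨v, hv, rfl⟩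
      have e := hL0 h.choose h.choose_spec.1
      rw [h.choose_spec.2] at e
      beta_reduce
      rw [dif_pos h]
      exact e
    set lam : V → ℕ := fun v => if v ∈ B then 0 else 1 + L (cmpt H E v) v with hlam
    have lamB : ∀ v ∈ B, lam v = 0 := fun v hv => by simp only [hlam, if_pos hv]
    have lamE : ∀ v, v ∉ B → lam v = 1 + L (cmpt H E v) v := fun v hv => by simp only [hlam, if_neg hv]
    have cnt : ∀ l, (C.filter (fun v => lam v < l)).card ≤ cc (2 * d * q + q) d l := by
      intro l
      cases l with
      | zero => simp [cc]
      | succ l =>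
        have hsub : C.filter (fun v => lam v < l + 1) ⊆ B ∪ (N B ∩ E).biUnion (fun x => (cmpt H E x).filter (fun w => L (cmpt H E x) w < l)) := by
          intro v hv
          rw [Finset.mem_filter] at hv
          by_cases hvB : v ∈ B
          · exact Finset.mem_union_left _ hvB
          · apply Finset.mem_union_right
            have hvE : v ∈ E := Finset.mem_sdiff.mpr ⟨hv.1, hvB⟩
            obtain ⟨x, hx⟩ := hatt v hvE
            rw [Finset.mem_inter] at hx
            have hxe := cmpt_eq hvE hx.2
            rw [Finset.mem_biUnion]
            refine ⟨x, Finset.mem_inter.mpr ⟨hx.1, cmpt_sub _ hx.2⟩, ?_⟩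
            rw [Finset.mem_filter, hxe]
            refine ⟨self_mem_cmpt hvE, ?_⟩
            have := lamE v hvB
            omega
        refine (Finset.card_le_card hsub).trans ((Finset.card_union_le _ _).trans ?_)
        have h1 := Finset.card_biUnion_le_card_mul (N B ∩ E) (fun x => (cmpt H E x).filter (fun w => L (cmpt H E x) w < l))
          (cc (2 * d * q + q) d l) (fun x hx => (hL x (Finset.mem_inter.mp hx).2).2.2.1 l)
        have h2 : (N B ∩ E).card ≤ (2 * d * q + q) * d :=
          ((Finset.card_le_card Finset.inter_subset_left).trans (hNc B)).trans (Nat.mul_le_mul_right _ hBc)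
        have h3 := Nat.mul_le_mul_right (cc (2 * d * q + q) d l) h2
        simp only [cc]
        omega
    refine ⟨lam, ?_, fun s hs => lamB s (Finset.mem_union_left _ hs), cnt, ?_⟩
    · intro u hu v hv huv
      by_cases hvB : v ∈ B
      · rw [lamB v hvB]; omega
      · have hvE : v ∈ E := Finset.mem_sdiff.mpr ⟨hv, hvB⟩
        by_cases huB : u ∈ B
        · rw [lamE v hvB, (hL v hvE).2.1 v (Finset.mem_inter.mpr ⟨(hNm _ _).mpr ⟨u, huB, huv⟩, self_mem_cmpt hvE⟩)]
          omega
        · have huE : u ∈ E := Finset.mem_sdiff.mpr ⟨hu, huB⟩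
          have hv' : v ∈ cmpt H E u := cmpt_adj (self_mem_cmpt huE) hvE huv
          have := (hL u huE).1 u (self_mem_cmpt huE) v hv' huv
          rw [lamE v hvB, lamE u huB, cmpt_eq huE hv']
          omega
    · intro a l K hKC hK hwin
      rcases Nat.eq_zero_or_pos a with rfl | ha
      · refine (Finset.card_le_card ?_).trans (cnt l)
        intro v hv
        rw [Finset.mem_filter]
        exact ⟨hKC hv, by simpa using (hwin v hv).2⟩
      · rcases K.eq_empty_or_nonempty with rfl | ⟨v, hv⟩
        · simp
        have hKB : ∀ w ∈ K, w ∉ B := by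
          intro w hw hwB
          have := (hwin w hw).1
          rw [lamB w hwB] at this
          omega
        have hKE : K ⊆ E := fun w hw => Finset.mem_sdiff.mpr ⟨hKC hw, hKB w hw⟩
        have hsub := conn_sub hK hKE hv
        refine (hL v (hKE hv)).2.2.2 (a - 1) l K hsub hK ?_
        intro w hw
        have h1 := hwin w hw
        rw [lamE w (hKB w hw), cmpt_eq (hKE hv) (hsub hw)] at h1
        omega

lemma level_global {d q : ℕ} (hdH : ∀ v, (Finset.univ.filter (H.Adj v)).card ≤ d)
    (hq : ∀ S : Finset V, ∃ Z : Finset V, Z.card ≤ q ∧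
      ∀ K, Conn H K → Disjoint K Z → 2 * d * (S ∩ K).card ≤ S.card) (hd : 1 ≤ d) (hq1 : 1 ≤ q) :
    ∃ lam : V → ℕ, (∀ u v, H.Adj u v → lam v ≤ lam u + 1) ∧
      (∀ a l, ∀ K, Conn H K → (∀ v ∈ K, a ≤ lam v ∧ lam v < a + l) → K.card ≤ cc (2 * d * q + q) d l) := by
  set E : Finset V := Finset.univ with hE
  have hall : ∀ K : Finset V, ∃ lam : V → ℕ, (∃ v, cmpt H E v = K) → (∀ u ∈ K, ∀ w ∈ K, H.Adj u w → lam w ≤ lam u + 1) ∧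
      (∀ a l, ∀ K' ⊆ K, Conn H K' → (∀ v ∈ K', a ≤ lam v ∧ lam v < a + l) → K'.card ≤ cc (2 * d * q + q) d l) := by
    intro K
    by_cases h : ∃ v, cmpt H E v = K
    · obtain ⟨v, rfl⟩ := h
      have hv : v ∈ E := Finset.mem_univ v
      obtain ⟨lam, h1, _, _, h4⟩ := level hdH hq hd _ (cmpt H E v) le_rfl (cmpt_conn hv) {v}
        (by simpa using self_mem_cmpt hv) (by simp) (by rw [Finset.card_singleton]; nlinarith)
      exact ⟨lam, fun _ => ⟨h1, h4⟩⟩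
    · exact ⟨fun _ => 0, fun h' => absurd h' h⟩
  choose L hL using hall
  refine ⟨fun v => L (cmpt H E v) v, ?_, ?_⟩
  · intro u v huv
    have hu : u ∈ E := Finset.mem_univ u
    have hv : v ∈ cmpt H E u := cmpt_adj (self_mem_cmpt hu) (Finset.mem_univ v) huv
    have := (hL _ ⟨u, rfl⟩).1 u (self_mem_cmpt hu) v hv huv
    beta_reduce
    rwa [cmpt_eq hu hv]
  · intro a l K hK hwin
    rcases K.eq_empty_or_nonempty with rfl | ⟨v, hv⟩
    · simp
    have hsub : K ⊆ cmpt H E v := conn_sub hK (Finset.subset_univ K) hv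
    refine (hL _ ⟨v, rfl⟩).2 a l K hsub hK ?_
    intro w hw
    have := hwin w hw
    beta_reduce at this
    have hvE : v ∈ E := Finset.mem_univ v
    rwa [cmpt_eq hvE (hsub hw)] at this

end


lemma exRoot {V : Type} [Fintype V] {G : SimpleGraph V} {f : V → ℝ × ℝ} (D : Drw G f) :
    ∃ rt : V → V, (∀ v, G.Reachable (rt v) v) ∧ (∀ u v, G.Reachable u v → rt u = rt v) ∧
    (∀ v u, G.Reachable (rt v) u → (f (rt v)).1 ≤ (f u).1) := by
  have : ∀ v, ∃ r, G.Reachable r v ∧ ∀ u, G.Reachable u v → (f r).1 ≤ (f u).1 := by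
    intro v
    obtain ⟨r, hr, hmin⟩ := Finset.exists_min_image (Finset.univ.filter (fun u => G.Reachable u v)) (fun u => (f u).1)
      ⟨v, by simp⟩
    simp only [Finset.mem_filter, Finset.mem_univ, true_and] at hr hmin
    exact ⟨r, hr, hmin⟩
  choose rt h1 h2 using this
  refine ⟨rt, h1, ?_, ?_⟩
  · intro u v huv
    apply D.inj
    exact le_antisymm (h2 u _ ((h1 v).trans huv.symm)) (h2 v _ ((h1 u).trans huv))
  · intro v u h
    exact h2 v u (h.symm.trans (h1 v))

lemma avg {V : Type} [Fintype V] (φ : V → ℕ) (T : ℕ) (hT : 0 < T) (w : V → ℝ) (hw : ∀ v, 0 ≤ w v) :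
    ∃ i, (T : ℝ) * ∑ v ∈ Finset.univ.filter (fun v => (φ v + i) % T = 0), w v ≤ ∑ v, w v := by
  by_contra hcon
  push Not at hcon
  have hdis : ((Finset.range T : Finset ℕ) : Set ℕ).PairwiseDisjoint
      (fun i => Finset.univ.filter (fun v => (φ v + i) % T = 0)) := by
    intro i hi j hj hne
    show Disjoint _ _
    rw [Finset.disjoint_left]
    intro v hv hv'
    simp only [Finset.mem_filter, Finset.mem_univ, true_and] at hv hv'
    simp only [Finset.coe_range, Set.mem_Iio] at hi hj
    apply hne
    have h : φ v + i ≡ φ v + j [MOD T] := hv.trans hv'.symm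
    exact (Nat.ModEq.add_left_cancel' (φ v) h).eq_of_lt_of_lt hi hj
  have h1 := Finset.sum_biUnion (f := w) hdis
  have h2 : ∑ v ∈ (Finset.range T).biUnion (fun i => Finset.univ.filter (fun v => (φ v + i) % T = 0)), w v ≤ ∑ v, w v :=
    Finset.sum_le_sum_of_subset_of_nonneg (Finset.subset_univ _) (fun v _ _ => hw v)
  have h3 : ∑ i ∈ Finset.range T, (∑ v, w v) < ∑ i ∈ Finset.range T, ((T : ℝ) * ∑ v ∈ Finset.univ.filter (fun v => (φ v + i) % T = 0), w v) :=
    Finset.sum_lt_sum_of_nonempty ⟨0, by simpa using hT⟩ (fun i _ => hcon i)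
  rw [← Finset.mul_sum, ← h1, Finset.sum_const, Finset.card_range, nsmul_eq_mul] at h3
  have hT' : (0 : ℝ) < T := by exact_mod_cast hT
  exact absurd (mul_le_mul_of_nonneg_left h2 hT'.le) (not_le.mpr h3)

lemma walk_closed {V : Type} {G : SimpleGraph V} {u v : V} (p : G.Walk u v) (A : Set V)
    (hA : ∀ a ∈ p.support, ∀ b ∈ p.support, G.Adj a b → a ∈ A → b ∈ A) (hu : u ∈ A) :
    ∀ x ∈ p.support, x ∈ A := by
  induction p with
  | nil => intro x hx; simp at hx; rwa [hx]
  | cons h q ih =>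
    rename_i a b c
    intro x hx
    rw [SimpleGraph.Walk.support_cons, List.mem_cons] at hx
    rcases hx with rfl | hx
    · exact hu
    · refine ih ?_ ?_ x hx
      · intro a ha b hb
        exact hA a (by simp [ha]) b (by simp [hb])
      · exact hA a (by simp) b (by simp) h hu

lemma walk_conn {V : Type} {G H : SimpleGraph V} {u v : V} (p : G.Walk u v)
    (hH : ∀ a ∈ p.support, ∀ b ∈ p.support, G.Adj a b → H.Adj a b) : Conn H p.support.toFinset := by
  intro A hA a ha b hb haA
  simp only [List.mem_toFinset] at hA ha hb
  have fwd : ∀ A : Set V, (∀ u ∈ p.support, ∀ w ∈ p.support, H.Adj u w → u ∈ A → w ∈ A) → u ∈ A →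
      ∀ w ∈ p.support, w ∈ A := fun A hA hu =>
    walk_closed p A (fun a ha b hb hab => hA a ha b hb (hH a ha b hb hab)) hu
  apply fwd A hA _ b hb
  by_contra hvA
  exact fwd Aᶜ (fun a ha b hb hab h1 h2 => h1 (hA b hb a ha hab.symm h2)) hvA a ha haA

lemma cc_le (b d : ℕ) (hd : 1 ≤ d) (l : ℕ) : cc b d l + 1 ≤ (b * d + 1) ^ l := by
  induction l with
  | zero => simp [cc]
  | succ l ih =>
    have h1 : 1 ≤ (b * d + 1) ^ l := Nat.one_le_pow _ _ (by omega)
    have h2 : b ≤ b * d := Nat.le_mul_of_pos_right _ hd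
    have h3 := Nat.mul_le_mul_left (b * d) ih
    simp only [cc]
    rw [pow_succ]
    nlinarith

lemma core {V : Type} [Fintype V] {G : SimpleGraph V} {f : V → ℝ × ℝ} (D : Drw G f)
    (d : ℕ) (hd1 : 1 ≤ d) (hd : ∀ v, (Finset.univ.filter (G.Adj v)).card ≤ d)
    (T : ℕ) (hT : 2 ≤ T) (w : V → ℝ) (hw : ∀ v, 0 ≤ w v) (q : ℕ) (hq : q = 8 * d * ((d + 5) * (T - 1))) :
    ∃ U : Finset V, (T : ℝ) * ∑ v ∈ U, w v ≤ 2 * ∑ v, w v ∧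
      ∀ (u v : V) (p : G.Walk u v), p.IsPath → (∀ x ∈ p.support, x ∉ U) →
        p.length + 1 ≤ cc (2 * d * q + q) d (T - 1) := by
  obtain ⟨rt, hrt1, hrt2, hrt3⟩ := exRoot D
  set lay : V → ℕ := fun v => G.dist (rt v) v with hlay
  obtain ⟨i, hi⟩ := avg lay T (by omega) w hw
  let H : SimpleGraph V :=
    { Adj := fun u v => G.Adj u v ∧ (lay u + i) % T ≠ 0 ∧ (lay v + i) % T ≠ 0
      symm := ⟨fun u v h => ⟨h.1.symm, h.2.2, h.2.1⟩⟩
      loopless := ⟨fun u h => h.1.ne rfl⟩ }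
  have hH : ∀ u v, H.Adj u v ↔ G.Adj u v ∧ (lay u + i) % T ≠ 0 ∧ (lay v + i) % T ≠ 0 := fun _ _ => Iff.rfl
  have hsep := sep D d hd rt hrt1 hrt2 hrt3 lay (fun _ => rfl) T i hT H hH
  have hdH : ∀ v, (Finset.univ.filter (H.Adj v)).card ≤ d := by
    intro v
    refine le_trans (Finset.card_le_card ?_) (hd v)
    intro u; simp only [Finset.mem_filter, Finset.mem_univ, true_and]
    exact fun h => h.1
  have hq2 : ∀ S : Finset V, ∃ Z : Finset V, Z.card ≤ q ∧
      ∀ K, Conn H K → Disjoint K Z → 2 * d * (S ∩ K).card ≤ S.card := by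
    intro S
    obtain ⟨Z, hZ, hZ2⟩ := halving hsep (Nat.log 2 (2 * d) + 1) S
    have l1 : 2 ^ (Nat.log 2 (2 * d)) ≤ 2 * d := Nat.pow_log_le_self 2 (by omega)
    have l2 : 2 * d < 2 ^ (Nat.log 2 (2 * d) + 1) := Nat.lt_pow_succ_log_self (by omega) _
    refine ⟨Z, hZ.trans ?_, fun K h1 h2 => (Nat.mul_le_mul_right _ l2.le).trans (hZ2 K h1 h2)⟩
    rw [hq, pow_succ, pow_succ, mul_comm (8 * d)]
    apply Nat.mul_le_mul_left
    omega
  have hq1 : 1 ≤ q := by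
    rw [hq]; exact Nat.mul_pos (by omega) (Nat.mul_pos (by omega) (by omega))
  obtain ⟨lam, hlam1, hlam2⟩ := level_global (d := d) (by intro v; convert hdH v) hq2 hd1 hq1
  obtain ⟨i', hi'⟩ := avg lam T (by omega) w hw
  refine ⟨Finset.univ.filter (fun v => (lay v + i) % T = 0) ∪ Finset.univ.filter (fun v => (lam v + i') % T = 0), ?_, ?_⟩
  · have h1 := Finset.sum_union_inter (s₁ := Finset.univ.filter (fun v => (lay v + i) % T = 0)) (s₂ := Finset.univ.filter (fun v => (lam v + i') % T = 0)) (f := w)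
    have h2 : 0 ≤ ∑ v ∈ (Finset.univ.filter (fun v => (lay v + i) % T = 0) ∩ Finset.univ.filter (fun v => (lam v + i') % T = 0)), w v :=
      Finset.sum_nonneg (fun v _ => hw v)
    have hT' : (0 : ℝ) ≤ T := Nat.cast_nonneg T
    nlinarith [mul_nonneg hT' h2]
  · intro u v p hp havoid
    simp only [Finset.mem_union, Finset.mem_filter, Finset.mem_univ, true_and, not_or] at havoid
    have hadj : ∀ a ∈ p.support, ∀ b ∈ p.support, G.Adj a b → H.Adj a b :=
      fun a ha b hb hab => ⟨hab, (havoid a ha).1, (havoid b hb).1⟩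
    have hK := walk_conn p hadj
    have hwin : ∀ x ∈ p.support, (lam x + i') / T = (lam u + i') / T := by
      apply walk_closed p {x | (lam x + i') / T = (lam u + i') / T}
      · intro a ha b hb hab h
        rw [Set.mem_setOf_eq] at h ⊢
        rw [← h]
        have := hlam1 a b (hadj a ha b hb hab)
        have := hlam1 b a (hadj a ha b hb hab).symm
        exact div_step (by omega) (by omega) (by omega) (havoid b hb).2 (havoid a ha).2
      · rfl
    have hcard : p.support.toFinset.card = p.length + 1 := by
      rw [List.toFinset_card_of_nodup hp.support_nodup, SimpleGraph.Walk.length_support]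
    rw [← hcard]
    apply hlam2 (T * ((lam u + i') / T) + 1 - i') (T - 1) _ hK
    intro x hx
    rw [List.mem_toFinset] at hx
    have e1 := hwin x hx
    have e2 := (havoid x hx).2
    have e3 := Nat.div_add_mod (lam x + i') T
    have e4 := Nat.mod_lt (lam x + i') (show T > 0 by omega)
    rw [e1] at e3
    omega

lemma arith (d t : ℕ) (hd : 1 ≤ d) (ht : 2 ≤ t) (q : ℕ) (hq : q = 8 * d * ((d + 5) * (2 * t - 1)))
    (K : ℕ) (hK : K = (54 * t - 29) * d * (d + 1) - 1) :
    cc (2 * d * q + q) d (2 * t - 1) ≤ ((K + 1) / 2) ^ (4 * t) := by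
  obtain ⟨s, hs⟩ : ∃ s, 2 * t - 1 = s := ⟨_, rfl⟩
  obtain ⟨A, hA⟩ : ∃ A, 54 * t - 29 = A := ⟨_, rfl⟩
  obtain ⟨m, hm⟩ : ∃ m, d * (d + 1) = m + m := Nat.even_mul_succ_self d
  rw [hs] at hq
  rw [hA] at hK
  have hA1 : 79 ≤ A := by omega
  have hA2 : 25 * s ≤ A := by omega
  have hs1 : 1 ≤ s := by omega
  have hm1 : 1 ≤ m := by nlinarith
  have hY : (K + 1) / 2 = A * m := by
    have : A * d * (d + 1) = 2 * (A * m) := by rw [mul_assoc, hm]; ring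
    rw [this] at hK
    have : 1 ≤ A * m := Nat.mul_pos (by omega) hm1
    omega
  have hmain : (2 * d * q + q) * d + 1 ≤ (A * m) ^ 2 := by
    have h1 : 1975 * s ≤ A * A := by nlinarith
    have h2 : 1975 * s * (d * (d + 1)) ^ 2 ≤ A * A * (d * (d + 1)) ^ 2 := Nat.mul_le_mul_right _ h1
    have h3 : A * A * (d * (d + 1)) ^ 2 = 4 * (A * m) ^ 2 := by rw [hm]; ring
    have h4 : 4 * ((2 * d * q + q) * d + 1) ≤ 1975 * s * (d * (d + 1)) ^ 2 := by
      rw [hq]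
      have h5 : 4 * (8 * ((d + 5) * (2 * d + 1)) + 1) ≤ 1975 * (d + 1) ^ 2 := by nlinarith
      have h6 := Nat.mul_le_mul_left (s * d ^ 2) h5
      have h7 : 1 ≤ s * d ^ 2 := Nat.mul_pos hs1 (by positivity)
      calc 4 * ((2 * d * (8 * d * ((d + 5) * s)) + 8 * d * ((d + 5) * s)) * d + 1)
          = s * d ^ 2 * (4 * (8 * ((d + 5) * (2 * d + 1)))) + 4 * 1 := by ring
        _ ≤ s * d ^ 2 * (4 * (8 * ((d + 5) * (2 * d + 1)))) + 4 * (s * d ^ 2) := by omega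
        _ = s * d ^ 2 * (4 * (8 * ((d + 5) * (2 * d + 1)) + 1)) := by ring
        _ ≤ s * d ^ 2 * (1975 * (d + 1) ^ 2) := h6
        _ = _ := by ring
    omega
  rw [hY, hs]
  calc cc (2 * d * q + q) d s ≤ ((2 * d * q + q) * d + 1) ^ s := by have := cc_le (2 * d * q + q) d hd s; omega
    _ ≤ ((A * m) ^ 2) ^ s := Nat.pow_le_pow_left hmain s
    _ = (A * m) ^ (2 * s) := by rw [pow_mul]
    _ ≤ (A * m) ^ (4 * t) := Nat.pow_le_pow_right (Nat.mul_pos (by omega) hm1) (by omega)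

/-- For `d, t ≥ 1`, every vertex-weighted planar graph of maximum degree at most `d`
has a `(t, ⌈K/2⌉^{4t})`-trimming, where `K = (54t-29)d(d+1) - 1`. -/
theorem trimming_of_planar_bounded_degree (d t : ℕ) (hd : 1 ≤ d) (ht : 1 ≤ t)
    {V : Type} [Fintype V] (G : SimpleGraph V) [DecidableRel G.Adj]
    (hplanar : IsPlanarStraight G) (hdeg : ∀ v : V, G.degree v ≤ d)
    (w : V → ℝ) (hw : ∀ v, 0 ≤ w v)
    (K : ℕ) (hK : K = (54 * t - 29) * d * (d + 1) - 1) :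
    ∃ U : Finset V, IsTrimming G w t ((((K + 1) / 2 : ℕ) : ℝ) ^ (4 * t)) U := by
  rcases Nat.lt_or_ge t 2 with h1 | h2
  · have : t = 1 := by omega
    subst this
    refine ⟨Finset.univ, by simp, ?_⟩
    intro u v p _ _
    exact ⟨u, by simp, by simp⟩
  · obtain ⟨f0, hf, a1, a2, a3⟩ := hplanar
    obtain ⟨f, D⟩ := exDrw f0 hf a1 a2 a3
    have hd' : ∀ v, (Finset.univ.filter (G.Adj v)).card ≤ d := by
      intro v
      have := hdeg v
      rw [← SimpleGraph.card_neighborFinset_eq_degree] at this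
      refine le_trans (Finset.card_le_card ?_) this
      intro u hu
      simpa using hu
    obtain ⟨U, hU1, hU2⟩ := core D d hd (by intro v; convert hd' v) (2 * t) (by omega) w hw _ rfl
    have htp : (0 : ℝ) < t := by exact_mod_cast ht
    refine ⟨U, ?_, ?_⟩
    · rw [le_div_iff₀ htp]
      push_cast at hU1
      linarith
    · intro u v p hp hlen
      by_contra hcon
      push Not at hcon
      have e1 := hU2 u v p hp hcon
      have e2 := arith d t hd h2 _ rfl K hK
      have e3 : p.length ≤ ((K + 1) / 2) ^ (4 * t) := by omega
      have e4 : (p.length : ℝ) ≤ (((K + 1) / 2 : ℕ) : ℝ) ^ (4 * t) := by exact_mod_cast e3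
      linarith
end
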